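/- arXiv:1412.7002 — 2 statements merged into one kernel-verified Lean document; each statement's English description precedes it below -/
import Mathlib

section
/- Let d = 1 and let ν be a locally bounded Borel measure on ℝ. Assume that b ∈ C(ℝ) satisfies |b(x)| ≤ C + C|x| and b = g + f, where f ≥ 0, g is a Lipschitz function with Lipschitz constant Λ, and g(x) < 0 implies f(x) = 0. Then the Cauchy problem ∂_t μ + ∂_x(b μ) = 0, μ|_{t=0} = ν has at most one solution in the class of all locally bounded measures μ given by families of locally bounded measures (μ_t)_{t∈[0,T]} such that |μ_t|(∂Z_f) = 0 for almost all t ∈ [0,T], where ∂Z_f is the topological boundary of the set Z_f = {x : f(x) = 0}. -/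
open MeasureTheory Metric Set Filter
open scoped Topology ENNReal

noncomputable section

/-- A family `(μ_t)_{t∈[0,T]}` of locally bounded signed Borel measures on `ℝ`,
represented by its Jordan decomposition `μ_t = p t - n t`:  each `p t`, `n t` is
finite on compact sets and they are mutually singular, `t ↦ μ_t(B)` is measurable
for bounded Borel `B`, and `t ↦ |μ_t|(K)` is in `L¹[0,T]` for every compact `K`. -/
def IsLocFamily1 (T : ℝ) (p n : ℝ → Measure ℝ) : Prop :=
  (∀ t ∈ Icc (0:ℝ) T, ∀ K : Set ℝ, IsCompact K → p t K < ⊤ ∧ n t K < ⊤) ∧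
  (∀ t ∈ Icc (0:ℝ) T, p t ⟂ₘ n t) ∧
  (∀ B : Set ℝ, MeasurableSet B → Bornology.IsBounded B →
      Measurable (fun t => p t B) ∧ Measurable (fun t => n t B)) ∧
  (∀ K : Set ℝ, IsCompact K →
      IntegrableOn (fun t => (p t K).toReal + (n t K).toReal) (Icc (0:ℝ) T))

/-- Integral of `f` against the signed measure `μ_t = p t - n t`. -/
def sint1 (p n : ℝ → Measure ℝ) (t : ℝ) (f : ℝ → ℝ) : ℝ :=
  (∫ x, f x ∂(p t)) - ∫ x, f x ∂(n t)

/-- The family `μ_t = p t - n t` of signed measures on `ℝ` is a solution of the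
Cauchy problem `∂_t μ + ∂_x (b μ) = 0`, `μ|_{t=0} = ν` (`ν = νp - νn`) on `[0,T]`:
`b` is `|μ|`-integrable on `U × [0,T]` for every bounded interval `U` and the
weak identity `∫ u(x,t) μ_t(dx) = ∫ u(x,0) ν(dx) + ∫₀ᵗ ∫ [∂_t u + b ∂_x u] μ_s(dx) ds`
holds for a.e. `t ∈ [0,T]`, for every `C¹` test function `u` vanishing for
`|x| > R` for some `R`. -/
def IsSolution1 (T : ℝ) (b : ℝ → ℝ) (νp νn : Measure ℝ) (p n : ℝ → Measure ℝ) : Prop :=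
  (∀ R : ℝ, 0 < R →
      (∫⁻ t in Icc (0:ℝ) T, ∫⁻ x in ball (0:ℝ) R, ENNReal.ofReal |b x| ∂(p t + n t)) < ⊤) ∧
  ∀ u : ℝ → ℝ → ℝ,
    ContDiff ℝ 1 (fun q : ℝ × ℝ => u q.1 q.2) →
    (∃ R > 0, ∀ x t, R < |x| → u x t = 0) →
    ∀ᵐ t ∂(volume.restrict (Icc (0:ℝ) T)),
      sint1 p n t (fun x => u x t)
        = ((∫ x, u x 0 ∂νp) - ∫ x, u x 0 ∂νn)
          + ∫ s in Icc (0:ℝ) t,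
              sint1 p n s (fun x => deriv (u x) s + b x * deriv (fun y => u y s) x)


/-! ### Flows of `C¹` vector fields on the line -/

/-- `X t x` is the position at time `t` of the integral curve of `v` starting from `x`. -/
def IsFlow (v : ℝ → ℝ) (X : ℝ → ℝ → ℝ) : Prop :=
  (∀ x, X 0 x = x) ∧ ∀ t x, HasDerivAt (fun s => X s x) (v (X t x)) t

/-- The derivative in the initial position of the flow `X` of the field `v`. -/
def flowJac (v : ℝ → ℝ) (X : ℝ → ℝ → ℝ) (t x : ℝ) : ℝ :=
  Real.exp (∫ s in (0:ℝ)..t, deriv v (X s x))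

/-- The mean value of `v'` over the segment from `a` to `b`. -/
def meanDeriv (v : ℝ → ℝ) (a b : ℝ) : ℝ :=
  ∫ θ in (0:ℝ)..1, deriv v (a + θ * (b - a))

theorem exists_integralCurve_of_bounded {v : ℝ → ℝ} {K : NNReal} {M : ℝ}
    (hv : LipschitzWith K v) (hM : ∀ x, |v x| ≤ M) (x : ℝ) :
    ∃ γ : ℝ → ℝ, γ 0 = x ∧ ∀ t, HasDerivAt γ (v (γ t)) t := by
  have hM0 : 0 ≤ M := (abs_nonneg _).trans (hM 0)
  lift M to NNReal using hM0
  have key : ∀ n : ℕ, ∃ γ : ℝ → ℝ, γ 0 = x ∧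
      ∀ t ∈ Ioo (-(n + 1 : ℝ)) (n + 1), HasDerivAt γ (v (γ t)) t := by
    intro n
    have h0 : (0:ℝ) ∈ Icc (-(n + 1 : ℝ)) (n + 1) := by
      constructor <;> [(have := n.cast_nonneg (α := ℝ); linarith); positivity]
    have hpl : IsPicardLindelof (fun _ => v) (tmin := -(n + 1 : ℝ)) (tmax := n + 1)
        ⟨0, h0⟩ x (M * (n + 1)) 0 M K :=
      { lipschitzOnWith := fun _ _ => hv.lipschitzOnWith
        continuousOn := fun _ _ => continuousOn_const
        norm_le := fun _ _ y _ => hM y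
        mul_max_le := by simp }
    obtain ⟨γ, h1, h2⟩ := hpl.exists_eq_forall_mem_Icc_hasDerivWithinAt₀
    exact ⟨γ, h1, fun t ht =>
      (h2 t (Ioo_subset_Icc_self ht)).hasDerivAt (Icc_mem_nhds ht.1 ht.2)⟩
  choose γ hγ0 hγ using key
  have huniq : ∀ m n : ℕ, m ≤ n → EqOn (γ m) (γ n) (Ioo (-(m + 1 : ℝ)) (m + 1)) := by
    intro m n hmn
    have hmn' : (m : ℝ) ≤ n := by exact_mod_cast hmn
    have hm : (0:ℝ) ≤ m := m.cast_nonneg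
    refine ODE_solution_unique_of_mem_Ioo (v := fun _ => v) (s := fun _ => univ) (t₀ := 0) (K := K)
      (fun _ _ => hv.lipschitzOnWith) ⟨by linarith, by linarith⟩
      (fun t ht => ⟨hγ m t ht, trivial⟩) (fun t ht => ⟨hγ n t ?_, trivial⟩)
      ((hγ0 m).trans (hγ0 n).symm)
    exact ⟨by linarith [ht.1], by linarith [ht.2]⟩
  refine ⟨fun t => γ ⌈|t|⌉₊ t, hγ0 _, fun t => ?_⟩
  set N := ⌈|t|⌉₊ + 1 with hN
  have ht : |t| < N := by
    have := Nat.le_ceil |t|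
    push_cast [hN]; linarith
  have hlt : t ∈ Ioo (-(N:ℝ)) N := abs_lt.1 ht
  have heq : ∀ s ∈ Ioo (-(N:ℝ)) N, γ ⌈|s|⌉₊ s = γ N s := by
    intro s hs
    refine huniq _ _ (Nat.ceil_le.2 (abs_lt.2 hs).le) ?_
    rw [mem_Ioo, ← abs_lt]
    have := Nat.le_ceil |s|
    linarith
  have hd : HasDerivAt (γ N) (v (γ N t)) t :=
    hγ N t ⟨by linarith [hlt.1], by linarith [hlt.2]⟩
  have hd' : HasDerivAt (γ N) (v (γ ⌈|t|⌉₊ t)) t := by rwa [heq t hlt]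
  exact hd'.congr_of_eventuallyEq
    (Filter.eventuallyEq_of_mem (Ioo_mem_nhds hlt.1 hlt.2) heq)

theorem exists_isFlow_of_bounded {v : ℝ → ℝ} {K : NNReal} {M : ℝ}
    (hv : LipschitzWith K v) (hM : ∀ x, |v x| ≤ M) : ∃ X, IsFlow v X := by
  choose γ h0 h1 using exists_integralCurve_of_bounded hv hM
  exact ⟨fun t x => γ x t, h0, fun t x => h1 x t⟩

theorem eq_mul_exp_integral_of_hasDerivAt {φ a : ℝ → ℝ} (ha : Continuous a)
    (hφ : ∀ t, HasDerivAt φ (a t * φ t) t) (t : ℝ) :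
    φ t = φ 0 * Real.exp (∫ s in (0:ℝ)..t, a s) := by
  have hI : ∀ t, HasDerivAt (fun t => ∫ s in (0:ℝ)..t, a s) (a t) t := fun t =>
    ha.integral_hasStrictDerivAt 0 t |>.hasDerivAt
  have hE : ∀ t, HasDerivAt (fun t => φ t * Real.exp (-∫ s in (0:ℝ)..t, a s)) 0 t := by
    intro t
    refine ((hφ t).mul (hI t).neg.exp).congr_deriv ?_
    simp only [Pi.neg_apply]
    ring
  have := is_const_of_deriv_eq_zero (fun t => (hE t).differentiableAt) (fun t => (hE t).deriv) t 0
  simp only [intervalIntegral.integral_same, neg_zero, Real.exp_zero, mul_one] at this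
  rw [← this, mul_assoc, ← Real.exp_add]
  simp

section Flow

variable {v : ℝ → ℝ} {X : ℝ → ℝ → ℝ} {K M : ℝ}

theorem continuous_meanDeriv (hv : ContDiff ℝ 1 v) :
    Continuous fun q : ℝ × ℝ => meanDeriv v q.1 q.2 := by
  have hd : Continuous (deriv v) := hv.continuous_deriv le_rfl
  unfold meanDeriv
  apply intervalIntegral.continuous_parametric_intervalIntegral_of_continuous'
  unfold Function.uncurry
  fun_prop

theorem meanDeriv_self (a : ℝ) : meanDeriv v a a = deriv v a := by
  simp [meanDeriv]

theorem sub_mul_meanDeriv (hv : ContDiff ℝ 1 v) (a b : ℝ) :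
    v b - v a = (b - a) * meanDeriv v a b := by
  have hd : Continuous (deriv v) := hv.continuous_deriv le_rfl
  have := intervalIntegral.integral_unitInterval_deriv_eq_sub (f := v) (f' := deriv v)
    (z₀ := a) (z₁ := b - a) (by fun_prop)
    (fun t _ => (hv.differentiable (by norm_num) _).hasDerivAt)
  simp only [smul_eq_mul, add_sub_cancel] at this
  rw [← this, meanDeriv]

theorem abs_meanDeriv_le (hK : ∀ x, |deriv v x| ≤ K) (a b : ℝ) : |meanDeriv v a b| ≤ K := by
  have := intervalIntegral.norm_integral_le_of_norm_le_const (a := 0) (b := 1) (C := K)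
    (f := fun θ => deriv v (a + θ * (b - a))) (fun θ _ => hK _)
  simpa [meanDeriv] using this

theorem IsFlow.continuous_time (hX : IsFlow v X) (x : ℝ) : Continuous fun t => X t x :=
  continuous_iff_continuousAt.2 fun t => (hX.2 t x).continuousAt

theorem IsFlow.sub_eq (hX : IsFlow v X) (hv : ContDiff ℝ 1 v) (t x y : ℝ) :
    X t y - X t x = (y - x) * Real.exp (∫ s in (0:ℝ)..t, meanDeriv v (X s x) (X s y)) := by
  have hc : Continuous fun s => meanDeriv v (X s x) (X s y) :=
    (continuous_meanDeriv hv).comp ((hX.continuous_time x).prodMk (hX.continuous_time y))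
  have := eq_mul_exp_integral_of_hasDerivAt (φ := fun t => X t y - X t x) hc (fun s => by
    refine ((hX.2 s y).sub (hX.2 s x)).congr_deriv ?_
    rw [sub_mul_meanDeriv hv]
    exact mul_comm _ _) t
  simpa only [hX.1] using this

theorem IsFlow.abs_sub_le (hX : IsFlow v X) (hv : ContDiff ℝ 1 v) (hK : ∀ x, |deriv v x| ≤ K)
    (t x y : ℝ) : |X t y - X t x| ≤ |y - x| * Real.exp (K * |t|) := by
  rw [hX.sub_eq hv, abs_mul, Real.abs_exp]
  gcongr
  have := intervalIntegral.norm_integral_le_of_norm_le_const (a := 0) (b := t) (C := K)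
    (f := fun s => meanDeriv v (X s x) (X s y)) (fun θ _ => abs_meanDeriv_le hK _ _)
  rw [sub_zero] at this
  exact (le_abs_self _).trans this

theorem IsFlow.abs_sub_time_le (hX : IsFlow v X) (hM : ∀ x, |v x| ≤ M) (x s t : ℝ) :
    |X t x - X s x| ≤ M * |t - s| :=
  Convex.norm_image_sub_le_of_norm_hasDerivWithin_le (s := univ)
    (fun r _ => (hX.2 r x).hasDerivWithinAt) (fun _ _ => hM _) convex_univ trivial trivial

theorem IsFlow.continuous (hX : IsFlow v X) (hv : ContDiff ℝ 1 v) (hK : ∀ x, |deriv v x| ≤ K) :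
    Continuous fun q : ℝ × ℝ => X q.1 q.2 := by
  rw [continuous_iff_continuousAt]
  rintro ⟨t, x⟩
  have h1 : Tendsto (fun q : ℝ × ℝ => X q.1 x) (𝓝 (t, x)) (𝓝 (X t x)) :=
    ((hX.continuous_time x).comp continuous_fst).tendsto (t, x)
  have h2 : Tendsto (fun q : ℝ × ℝ => X q.1 q.2 - X q.1 x) (𝓝 (t, x)) (𝓝 0) := by
    refine squeeze_zero_norm (fun q => hX.abs_sub_le hv hK q.1 x q.2) ?_
    have : Continuous fun q : ℝ × ℝ => |q.2 - x| * Real.exp (K * |q.1|) := by fun_prop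
    simpa using this.tendsto (t, x)
  simpa [ContinuousAt] using h2.add h1

theorem IsFlow.hasDerivAt_space (hX : IsFlow v X) (hv : ContDiff ℝ 1 v)
    (hK : ∀ x, |deriv v x| ≤ K) (t x : ℝ) :
    HasDerivAt (fun y => X t y) (flowJac v X t x) x := by
  have hXc := hX.continuous hv hK
  rw [hasDerivAt_iff_tendsto_slope]
  have hc : Continuous fun y => Real.exp (∫ s in (0:ℝ)..t, meanDeriv v (X s x) (X s y)) := by
    refine Real.continuous_exp.comp
      (intervalIntegral.continuous_parametric_intervalIntegral_of_continuous' ?_ _ _)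
    exact (continuous_meanDeriv hv).comp (((hX.continuous_time x).comp continuous_snd).prodMk
      (hXc.comp (continuous_snd.prodMk continuous_fst)))
  have hlim := (hc.tendsto x).mono_left (nhdsWithin_le_nhds (s := {x}ᶜ))
  simp only [meanDeriv_self] at hlim
  refine hlim.congr' ?_
  filter_upwards [self_mem_nhdsWithin] with y hy
  have hne : y - x ≠ 0 := sub_ne_zero.2 hy
  rw [slope_def_field, hX.sub_eq hv]
  field_simp

theorem IsFlow.continuous_flowJac (hX : IsFlow v X) (hv : ContDiff ℝ 1 v)
    (hK : ∀ x, |deriv v x| ≤ K) : Continuous fun q : ℝ × ℝ => flowJac v X q.1 q.2 := by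
  have hXc := hX.continuous hv hK
  have hd : Continuous (deriv v) := hv.continuous_deriv le_rfl
  refine Real.continuous_exp.comp
    (intervalIntegral.continuous_parametric_intervalIntegral_of_continuous ?_ continuous_fst)
  exact hd.comp (hXc.comp (continuous_snd.prodMk (continuous_snd.comp continuous_fst)))

theorem IsFlow.contDiff (hX : IsFlow v X) (hv : ContDiff ℝ 1 v) (hK : ∀ x, |deriv v x| ≤ K) :
    ContDiff ℝ 1 fun q : ℝ × ℝ => X q.1 q.2 := by
  have hXc := hX.continuous hv hK
  have hJ := hX.continuous_flowJac hv hK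
  let L : ℝ →L[ℝ] ℝ →L[ℝ] ℝ :=
    (ContinuousLinearMap.toSpanSingletonCLE (𝕜 := ℝ) (E := ℝ)).toContinuousLinearMap
  have c1 : Continuous fun q : ℝ × ℝ => L (v (X q.1 q.2)) :=
    L.continuous.comp (hv.continuous.comp hXc)
  have c2 : Continuous fun q : ℝ × ℝ => L (flowJac v X q.1 q.2) := L.continuous.comp hJ
  rw [contDiff_one_iff_hasFDerivAt]
  refine ⟨fun q => (L (v (X q.1 q.2))).coprod (L (flowJac v X q.1 q.2)), ?_, fun q => ?_⟩
  · have : Continuous fun q : ℝ × ℝ =>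
        (L (v (X q.1 q.2))).comp (ContinuousLinearMap.fst ℝ ℝ ℝ)
          + (L (flowJac v X q.1 q.2)).comp (ContinuousLinearMap.snd ℝ ℝ ℝ) :=
      (c1.clm_comp continuous_const).add (c2.clm_comp continuous_const)
    simpa only [ContinuousLinearMap.comp_fst_add_comp_snd] using this
  · exact (hasStrictFDerivAt_uncurry_coprod (f := X) (f₁ := fun t x => L (v (X t x)))
      (f₂ := fun t x => L (flowJac v X t x))
      (Eventually.of_forall fun w => (hX.2 w.1 w.2).hasFDerivAt)
      (Eventually.of_forall fun w => (hX.hasDerivAt_space hv hK w.1 w.2).hasFDerivAt)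
      c1.continuousAt c2.continuousAt).hasFDerivAt

theorem IsFlow.map_eq (hX : IsFlow v X) (hv : ContDiff ℝ 1 v) (t x : ℝ) :
    v (X t x) = v x * flowJac v X t x := by
  have hd : Continuous (deriv v) := hv.continuous_deriv le_rfl
  have := eq_mul_exp_integral_of_hasDerivAt (φ := fun t => v (X t x))
    (hd.comp (hX.continuous_time x))
    (fun s => (hv.differentiable (by norm_num) _).hasDerivAt.comp s (hX.2 s x)) t
  simpa only [hX.1, Function.comp_def, flowJac] using this

end Flow

section OneSided

variable {v : ℝ → ℝ} {X : ℝ → ℝ → ℝ} {Λ c M : ℝ}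

theorem flowJac_pos (v : ℝ → ℝ) (X : ℝ → ℝ → ℝ) (t x : ℝ) : 0 < flowJac v X t x := Real.exp_pos _

theorem IsFlow.continuous_deriv_comp (hX : IsFlow v X) (hv : ContDiff ℝ 1 v) (x : ℝ) :
    Continuous fun s => deriv v (X s x) :=
  (hv.continuous_deriv le_rfl).comp (hX.continuous_time x)

theorem IsFlow.flowJac_le_exp (hX : IsFlow v X) (hv : ContDiff ℝ 1 v) {t x : ℝ} (ht : 0 ≤ t)
    (h : ∀ s ∈ Ioo 0 t, deriv v (X s x) ≤ Λ) : flowJac v X t x ≤ Real.exp (Λ * t) := by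
  refine Real.exp_le_exp.2 ?_
  have := intervalIntegral.integral_mono_on_of_le_Ioo (μ := volume) ht
    ((hX.continuous_deriv_comp hv x).intervalIntegrable 0 t)
    (intervalIntegrable_const (c := Λ)) h
  simpa [mul_comm] using this

theorem IsFlow.flowJac_le_exp_of_neg (hX : IsFlow v X) (hv : ContDiff ℝ 1 v) (hc : 0 ≤ c)
    (h : ∀ x, deriv v x ≤ Λ ∨ c ≤ v x) {t x : ℝ} (ht : 0 ≤ t) (hx : v x < 0) :
    flowJac v X t x ≤ Real.exp (Λ * t) := by
  refine hX.flowJac_le_exp hv ht fun s _ => (h _).resolve_right (not_le.2 ?_)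
  rw [hX.map_eq hv]
  exact (mul_neg_of_neg_of_pos hx (flowJac_pos _ _ _ _)).trans_le hc

theorem IsFlow.flowJac_eq_mul (hX : IsFlow v X) (hv : ContDiff ℝ 1 v) (s t x : ℝ) :
    flowJac v X t x = flowJac v X s x * Real.exp (∫ r in s..t, deriv v (X r x)) := by
  have hc := hX.continuous_deriv_comp hv x
  rw [flowJac, flowJac, ← Real.exp_add, intervalIntegral.integral_add_adjacent_intervals
    (hc.intervalIntegrable _ _) (hc.intervalIntegrable _ _)]

/-- If `v` is one-sided Lipschitz wherever it is smaller than `c`, then the Jacobian of its flow is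
at most of order `1 / c`. -/
theorem IsFlow.mul_flowJac_le (hX : IsFlow v X) (hv : ContDiff ℝ 1 v) (hΛ : 0 ≤ Λ) (hc : 0 < c)
    (hcM : c ≤ M) (hM : ∀ x, |v x| ≤ M) (h : ∀ x, deriv v x ≤ Λ ∨ c ≤ v x) {t x : ℝ}
    (ht : 0 ≤ t) : c * flowJac v X t x ≤ M * Real.exp (Λ * t) := by
  by_cases! hhit : ∃ s ∈ Icc 0 t, c ≤ v (X s x)
  · obtain ⟨s, ⟨⟨hs0, hst⟩, hs⟩, hmin⟩ :=
      (isCompact_Icc.inter_right (isClosed_le continuous_const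
        (hv.continuous.comp (hX.continuous_time x)))).exists_isLeast
          (s := Icc 0 t ∩ {s | c ≤ v (X s x)}) hhit
    have h1 : flowJac v X s x ≤ Real.exp (Λ * s) :=
      hX.flowJac_le_exp hv hs0 fun r hr => (h _).resolve_right fun hr' =>
        absurd (hmin ⟨⟨hr.1.le, hr.2.le.trans hst⟩, hr'⟩) (not_le.2 hr.2)
    have h2 := hX.flowJac_eq_mul hv s t x
    set E := Real.exp (∫ r in s..t, deriv v (X r x)) with hE
    have hE0 : 0 < E := Real.exp_pos _
    have h3 : v (X s x) * E = v (X t x) := by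
      rw [hX.map_eq hv, hX.map_eq hv, h2, mul_assoc]
    have h4 : c * E ≤ M := by
      refine (mul_le_mul_of_nonneg_right hs hE0.le).trans ?_
      rw [h3]
      exact (le_abs_self _).trans (hM _)
    calc c * flowJac v X t x = (c * E) * flowJac v X s x := by rw [h2]; ring
      _ ≤ M * Real.exp (Λ * s) :=
        mul_le_mul h4 h1 (flowJac_pos _ _ _ _).le (hc.le.trans hcM)
      _ ≤ M * Real.exp (Λ * t) := by
        have := hc.le.trans hcM
        gcongr
  · have h1 : flowJac v X t x ≤ Real.exp (Λ * t) :=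
      hX.flowJac_le_exp hv ht fun s hs =>
        (h _).resolve_right (not_le.2 (hhit s (Ioo_subset_Icc_self hs)))
    exact mul_le_mul hcM h1 (flowJac_pos _ _ _ _).le (hc.le.trans hcM)

/-- An integral curve starting where `v` is small stays for a long time in a region where `v` is
one-sided Lipschitz. -/
theorem IsFlow.flowJac_le_exp_of_small (hX : IsFlow v X) (hv : ContDiff ℝ 1 v) (hΛ : 0 ≤ Λ)
    {r x t : ℝ} (hloc : ∀ y, |y - x| < r → deriv v y ≤ Λ) (ht : 0 ≤ t)
    (hsmall : |v x| * Real.exp (Λ * t) * t < r) : flowJac v X t x ≤ Real.exp (Λ * t) := by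
  suffices hstay : ∀ s ∈ Icc 0 t, |X s x - x| < r from
    hX.flowJac_le_exp hv ht fun s hs => hloc _ (hstay s (Ioo_subset_Icc_self hs))
  by_contra! hhit
  obtain ⟨s, ⟨⟨hs0, hst⟩, hs⟩, hmin⟩ :=
    (isCompact_Icc.inter_right (isClosed_le continuous_const
      ((hX.continuous_time x).sub continuous_const).abs)).exists_isLeast
        (s := Icc 0 t ∩ {s | r ≤ |X s x - x|}) hhit
  have hbefore : ∀ q ∈ Ico 0 s, |X q x - x| < r := fun q hq => by
    by_contra! hq'
    exact absurd (hmin ⟨⟨hq.1, hq.2.le.trans hst⟩, hq'⟩) (not_le.2 hq.2)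
  have hspeed : ∀ q ∈ Ico 0 s, ‖v (X q x)‖ ≤ |v x| * Real.exp (Λ * t) := by
    intro q hq
    rw [hX.map_eq hv, norm_mul, Real.norm_eq_abs, Real.norm_of_nonneg (flowJac_pos _ _ _ _).le]
    gcongr
    refine (hX.flowJac_le_exp hv hq.1 fun p hp =>
      hloc _ (hbefore p ⟨hp.1.le, hp.2.trans hq.2⟩)).trans ?_
    have := hq.2.le.trans hst
    gcongr
  have := norm_image_sub_le_of_norm_deriv_right_le_segment (a := 0) (b := s)
    (hX.continuous_time x).continuousOn (fun q _ => (hX.2 q x).hasDerivWithinAt) hspeed s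
    (right_mem_Icc.2 hs0)
  rw [hX.1, sub_zero, Real.norm_eq_abs] at this
  have h3 : |v x| * Real.exp (Λ * t) * s ≤ |v x| * Real.exp (Λ * t) * t := by gcongr
  have hs' : r ≤ |X s x - x| := hs
  linarith

theorem IsFlow.abs_le_gronwallBound (hX : IsFlow v X) {A C R T t x : ℝ} (hR : 0 ≤ R) (hA : 0 ≤ A)
    (hC : 0 ≤ C) (hv : ∀ x, |v x| ≤ A + C * |x|) (ht : 0 ≤ t) (htT : t ≤ T) (h : |X t x| ≤ R) :
    |x| ≤ gronwallBound R C A T := by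
  have hd : ∀ s, HasDerivAt (fun s => X (t - s) x) (-v (X (t - s) x)) s := fun s => by
    simpa using (hX.2 (t - s) x).comp_const_sub t s
  have := norm_le_gronwallBound_of_norm_deriv_right_le (a := 0) (b := t) (δ := R) (K := C) (ε := A)
    (fun s _ => (hd s).continuousAt.continuousWithinAt) (fun s _ => (hd s).hasDerivWithinAt)
    (by simpa using h) (fun s _ => by
      rw [norm_neg, add_comm]; exact hv _) t (right_mem_Icc.2 ht)
  rw [sub_self, hX.1, sub_zero] at this
  exact this.trans (gronwallBound_mono hR hA hC htT)

end OneSided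

/-! ### Regularization by moving averages -/

/-- The average of `b` over `[x, x + δ]`. -/
def movingAverage (b : ℝ → ℝ) (δ x : ℝ) : ℝ := δ⁻¹ * ∫ s in x..x + δ, b s

section MovingAverage

variable {b : ℝ → ℝ} {δ : ℝ}

theorem hasDerivAt_movingAverage (hb : Continuous b) (δ x : ℝ) :
    HasDerivAt (movingAverage b δ) (δ⁻¹ * (b (x + δ) - b x)) x := by
  have h : ∀ y, HasDerivAt (fun y => ∫ s in (0:ℝ)..y, b s) (b y) y := fun y =>
    (hb.integral_hasStrictDerivAt 0 y).hasDerivAt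
  have := (((h (x + δ)).comp_add_const x δ).sub (h x)).const_mul δ⁻¹
  refine this.congr_of_eventuallyEq (Eventually.of_forall fun y => ?_)
  simp only [movingAverage, Pi.sub_apply]
  rw [intervalIntegral.integral_interval_sub_left (hb.intervalIntegrable _ _)
    (hb.intervalIntegrable _ _)]

theorem deriv_movingAverage (hb : Continuous b) (δ x : ℝ) :
    deriv (movingAverage b δ) x = δ⁻¹ * (b (x + δ) - b x) :=
  (hasDerivAt_movingAverage hb δ x).deriv

theorem contDiff_movingAverage (hb : Continuous b) (δ : ℝ) : ContDiff ℝ 1 (movingAverage b δ) := by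
  rw [contDiff_one_iff_deriv]
  refine ⟨fun x => (hasDerivAt_movingAverage hb δ x).differentiableAt, ?_⟩
  rw [funext (deriv_movingAverage hb δ)]
  fun_prop

theorem le_movingAverage (hb : Continuous b) (hδ : 0 < δ) {c x : ℝ}
    (h : ∀ y ∈ Icc x (x + δ), c ≤ b y) : c ≤ movingAverage b δ x := by
  have := intervalIntegral.integral_mono_on (μ := volume) (by linarith : x ≤ x + δ)
    (intervalIntegrable_const (c := c)) (hb.intervalIntegrable _ _) h
  rw [intervalIntegral.integral_const, add_sub_cancel_left, smul_eq_mul] at this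
  rw [movingAverage, inv_mul_eq_div, le_div_iff₀ hδ]
  linarith

theorem movingAverage_le (hb : Continuous b) (hδ : 0 < δ) {c x : ℝ}
    (h : ∀ y ∈ Icc x (x + δ), b y ≤ c) : movingAverage b δ x ≤ c := by
  have := intervalIntegral.integral_mono_on (μ := volume) (by linarith : x ≤ x + δ)
    (hb.intervalIntegrable _ _) (intervalIntegrable_const (c := c)) h
  rw [intervalIntegral.integral_const, add_sub_cancel_left, smul_eq_mul] at this
  rw [movingAverage, inv_mul_eq_div, div_le_iff₀ hδ]
  linarith

end MovingAverage

/-- Smooth fields `v` close to `b = g + f` which are one-sided Lipschitz wherever they are not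
bounded below by a fraction of the distance to `b`. -/
theorem exists_smooth_approx {b g f : ℝ → ℝ} {M ε : ℝ} {Λ : NNReal} (hb : UniformContinuous b)
    (hM : ∀ x, |b x| ≤ M) (hsum : ∀ x, b x = g x + f x) (hf0 : ∀ x, 0 ≤ f x)
    (hg : LipschitzWith Λ g) (hsign : ∀ x, g x < 0 → f x = 0) (hε : 0 < ε) :
    ∃ v : ℝ → ℝ, ContDiff ℝ 1 v ∧ (∃ K, ∀ x, |deriv v x| ≤ K) ∧ (∀ x, |v x - b x| ≤ 2 * ε) ∧
      (∀ x, deriv v x ≤ Λ ∨ ε / 2 ≤ v x) ∧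
      ∀ x, (∀ y ∈ Icc x (x + ε), f y = 0) → deriv v x ≤ Λ := by
  obtain ⟨η, hη, hbη⟩ := Metric.uniformContinuous_iff.1 hb ε hε
  obtain ⟨δ, hδ, hδη, hδε, hδΛ⟩ : ∃ δ > 0, δ < η ∧ δ ≤ ε ∧ Λ * δ ≤ ε / 2 := by
    have hΛ : (0:ℝ) < Λ + 1 := by positivity
    refine ⟨min (η / 2) (min ε (ε / 2 / (Λ + 1))), by positivity,
      (min_le_left _ _).trans_lt (by linarith),
      (min_le_right _ _).trans (min_le_left _ _), ?_⟩
    have h1 : min (η / 2) (min ε (ε / 2 / (Λ + 1))) ≤ ε / 2 / (Λ + 1) :=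
      (min_le_right _ _).trans (min_le_right _ _)
    rw [le_div_iff₀ hΛ] at h1
    have h2 : 0 < min (η / 2) (min ε (ε / 2 / (Λ + 1))) := by positivity
    nlinarith
  have hbc := hb.continuous
  have hder : ∀ x, deriv (fun x => movingAverage b δ x + ε) x = δ⁻¹ * (b (x + δ) - b x) :=
    fun x => ((hasDerivAt_movingAverage hbc δ x).add_const ε).deriv
  have hlip : ∀ x y, |g x - g y| ≤ Λ * |x - y| := fun x y => hg.dist_le_mul x y
  have hone : ∀ x, f (x + δ) ≤ 0 → deriv (fun x => movingAverage b δ x + ε) x ≤ Λ := by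
    intro x hx
    rw [hder, inv_mul_eq_div, div_le_iff₀ hδ, hsum, hsum]
    have h1 := (le_abs_self _).trans (hlip (x + δ) x)
    rw [add_sub_cancel_left, abs_of_pos hδ] at h1
    linarith [hf0 x]
  refine ⟨fun x => movingAverage b δ x + ε, (contDiff_movingAverage hbc δ).add contDiff_const,
    ⟨δ⁻¹ * (2 * M), fun x => ?_⟩, fun x => ?_, fun x => ?_, fun x hx => ?_⟩
  · rw [hder, abs_mul, abs_of_pos (inv_pos.2 hδ)]
    gcongr
    refine (abs_sub _ _).trans ?_
    linarith [hM (x + δ), hM x]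
  · have hclose : ∀ y ∈ Icc x (x + δ), |b y - b x| < ε := fun y hy =>
      hbη (by
        rw [Real.dist_eq, abs_of_nonneg (by linarith [hy.1])]
        linarith [hy.2])
    have h1 : b x - ε ≤ movingAverage b δ x :=
      le_movingAverage hbc hδ fun y hy => by linarith [(abs_lt.1 (hclose y hy)).1]
    have h2 : movingAverage b δ x ≤ b x + ε :=
      movingAverage_le hbc hδ fun y hy => by linarith [(abs_lt.1 (hclose y hy)).2]
    rw [abs_le]
    constructor <;> linarith
  · rcases le_or_gt (f (x + δ)) 0 with h | h
    · exact Or.inl (hone x h)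
    · right
      have hgx : 0 ≤ g (x + δ) := by
        by_contra! hneg
        exact h.ne' (hsign _ hneg)
      have : -(Λ * δ) ≤ movingAverage b δ x := by
        refine le_movingAverage hbc hδ fun y hy => ?_
        have h1 := (le_abs_self _).trans (hlip (x + δ) y)
        rw [abs_of_nonneg (by linarith [hy.2] : 0 ≤ x + δ - y)] at h1
        have h2 : (Λ:ℝ) * (x + δ - y) ≤ Λ * δ :=
          mul_le_mul_of_nonneg_left (by linarith [hy.1]) Λ.2
        rw [hsum]
        linarith [hf0 y]
      show ε / 2 ≤ movingAverage b δ x + ε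
      linarith
  · exact hone x (hx _ ⟨by linarith, by linarith⟩).le

/-- Smooth flows approximating the (possibly non-unique) flow of `b = g + f`, with
`|b - vₖ|` controlled by the Jacobian of the flow of `vₖ`. -/
theorem exists_approx_flows {b g f : ℝ → ℝ} {M T : ℝ} {Λ : NNReal}
    (hb : UniformContinuous b)
    (hM : ∀ x, |b x| ≤ M) (hsum : ∀ x, b x = g x + f x) (hf0 : ∀ x, 0 ≤ f x)
    (hg : LipschitzWith Λ g) (hsign : ∀ x, g x < 0 → f x = 0) :
    ∃ (v : ℕ → ℝ → ℝ) (X : ℕ → ℝ → ℝ → ℝ) (A : ℝ),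
      (∀ k, ContDiff ℝ 1 (v k)) ∧ (∀ k, ∃ K, ∀ x, |deriv (v k) x| ≤ K) ∧
      (∀ k, IsFlow (v k) (X k)) ∧ (∀ k x, |v k x - b x| ≤ 1) ∧
      (∀ k, ∀ t ∈ Icc 0 T, ∀ x, |b x - v k x| * flowJac (v k) (X k) t x ≤ A) ∧
      ∀ t ∈ Icc 0 T, ∀ x, (f x ≠ 0 ∨ ∀ᶠ y in 𝓝 x, f y = 0) →
        Tendsto (fun k => |b x - v k x| * flowJac (v k) (X k) t x) atTop (𝓝 0) := by
  set ε : ℕ → ℝ := fun k => 1 / 2 * (1 / ((k:ℝ) + 1)) with hεdef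
  have hε0 : ∀ k, 0 < ε k := fun k => by simp only [hεdef]; positivity
  have hε1 : ∀ k, 2 * ε k ≤ 1 := fun k => by
    have : 1 / ((k:ℝ) + 1) ≤ 1 := by
      rw [div_le_one (by positivity)]
      linarith [k.cast_nonneg (α := ℝ)]
    simp only [hεdef]
    linarith
  have hεlim : Tendsto ε atTop (𝓝 0) := by
    simpa [hεdef] using (tendsto_one_div_add_atTop_nhds_zero_nat (𝕜 := ℝ)).const_mul (1 / 2 : ℝ)
  have hM0 : 0 ≤ M := (abs_nonneg _).trans (hM 0)
  choose v hv hK hclose hdich hloc using fun k =>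
    exists_smooth_approx hb hM hsum hf0 hg hsign (hε0 k)
  have hvM : ∀ k x, |v k x| ≤ M + 1 := fun k x => by
    have h1 := abs_add_le (v k x - b x) (b x)
    rw [sub_add_cancel] at h1
    linarith [hM x, hclose k x, hε1 k]
  have hflow : ∀ k, ∃ X, IsFlow (v k) X := fun k => by
    obtain ⟨K, hK⟩ := hK k
    exact exists_isFlow_of_bounded (K := K.toNNReal)
      (lipschitzWith_of_nnnorm_deriv_le ((hv k).differentiable (by norm_num)) fun x => by
        rw [← NNReal.coe_le_coe, coe_nnnorm]
        exact (hK x).trans (Real.le_coe_toNNReal K)) (hvM k)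
  choose X hX using hflow
  have hexp : ∀ t ∈ Icc 0 T, Real.exp (Λ * t) ≤ Real.exp (Λ * T) := fun t ht => by
    have := ht.2
    gcongr
  refine ⟨v, X, 4 * ((M + 1) * Real.exp (Λ * T)), hv, hK, hX,
    fun k x => (hclose k x).trans (hε1 k), fun k t ht x => ?_, fun t ht x hx => ?_⟩
  · have h1 := (hX k).mul_flowJac_le (hv k) Λ.2 (half_pos (hε0 k)) (M := M + 1)
      (by linarith [hε1 k]) (hvM k) (hdich k) (x := x) ht.1
    have h2 : (M + 1) * Real.exp (Λ * t) ≤ (M + 1) * Real.exp (Λ * T) :=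
      mul_le_mul_of_nonneg_left (hexp t ht) (by linarith)
    have h3 : |b x - v k x| * flowJac (v k) (X k) t x ≤ 2 * ε k * flowJac (v k) (X k) t x :=
      mul_le_mul_of_nonneg_right (by rw [abs_sub_comm]; exact hclose k x) (flowJac_pos _ _ _ _).le
    change ε k / 2 * flowJac (v k) (X k) t x ≤ (M + 1) * Real.exp (Λ * t) at h1
    linarith
  · suffices hbd : ∃ B, ∀ᶠ k in atTop, flowJac (v k) (X k) t x ≤ B by
      obtain ⟨B, hB⟩ := hbd
      have hlim : Tendsto (fun k => 2 * ε k * B) atTop (𝓝 0) := by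
        simpa using (hεlim.const_mul 2).mul_const B
      refine squeeze_zero' (Eventually.of_forall fun k =>
        mul_nonneg (abs_nonneg _) (flowJac_pos _ _ _ _).le) ?_ hlim
      filter_upwards [hB] with k hk
      exact mul_le_mul (by rw [abs_sub_comm]; exact hclose k x) hk (flowJac_pos _ _ _ _).le
        (by linarith [hε0 k])
    rcases lt_trichotomy (b x) 0 with hneg | hzero | hpos
    · refine ⟨Real.exp (Λ * T), ?_⟩
      filter_upwards [hεlim.eventually (gt_mem_nhds (by linarith : 0 < -b x / 2))] with k hk
      refine ((hX k).flowJac_le_exp_of_neg (hv k) (half_pos (hε0 k)).le (hdich k) ht.1 ?_).trans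
        (hexp t ht)
      linarith [(abs_le.1 (hclose k x)).2]
    · have hfx : f x = 0 := by
        by_contra hne
        have hfpos : 0 < f x := lt_of_le_of_ne (hf0 x) (Ne.symm hne)
        have : g x < 0 := by linarith [hsum x]
        exact hne (hsign x this)
      obtain ⟨r, hr, hball⟩ := Metric.eventually_nhds_iff.1 (hx.resolve_left (by simpa using hfx))
      refine ⟨Real.exp (Λ * T), ?_⟩
      have hlim : Tendsto (fun k => 2 * ε k * Real.exp (Λ * t) * t) atTop (𝓝 0) := by
        simpa using ((hεlim.const_mul 2).mul_const _).mul_const t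
      filter_upwards [hεlim.eventually (gt_mem_nhds (half_pos hr)),
        hlim.eventually (gt_mem_nhds (half_pos hr))] with k hk1 hk2
      refine ((hX k).flowJac_le_exp_of_small (hv k) Λ.2 (r := r / 2) (fun y hy => ?_) ht.1
        (lt_of_le_of_lt ?_ hk2)).trans (hexp t ht)
      · refine hloc k y fun z hz => hball ?_
        rw [abs_lt] at hy
        rw [Real.dist_eq, abs_lt]
        constructor <;> linarith [hz.1, hz.2]
      · have hvx : |v k x| ≤ 2 * ε k := by
          have := hclose k x
          rwa [hzero, sub_zero] at this
        have := ht.1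
        change |v k x| * Real.exp (Λ * t) * t ≤ _
        gcongr
    · refine ⟨(M + 1) / (b x / 2), ?_⟩
      filter_upwards [hεlim.eventually (gt_mem_nhds (by linarith : 0 < b x / 4))] with k hk
      rw [le_div_iff₀ (half_pos hpos)]
      have h1 : b x / 2 ≤ v k x := by linarith [(abs_le.1 (hclose k x)).1]
      have h2 := (hX k).map_eq (hv k) t x
      have h3 := (le_abs_self _).trans (hvM k (X k t x))
      rw [h2] at h3
      have := mul_le_mul_of_nonneg_right h1 (flowJac_pos (v k) (X k) t x).le
      linarith

section Duality

theorem tendsto_integral_zero_of_dominated {α : Type*} [MeasurableSpace α] {μ : Measure α}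
    {F : ℕ → α → ℝ} {G : α → ℝ} (hG : Integrable G μ) (hF : ∀ k, ∀ᵐ s ∂μ, |F k s| ≤ G s)
    (hlim : ∀ᵐ s ∂μ, Tendsto (fun k => F k s) atTop (𝓝 0)) :
    Tendsto (fun k => ∫ s, F k s ∂μ) atTop (𝓝 0) := by
  classical
  let F' : ℕ → α → ℝ := fun k => if AEStronglyMeasurable (F k) μ then F k else 0
  have hle : ∀ k s, |F' k s| ≤ |F k s| := fun k s => by
    by_cases h : AEStronglyMeasurable (F k) μ <;> simp [F', h]
  have hint : ∀ k, ∫ s, F k s ∂μ = ∫ s, F' k s ∂μ := fun k => by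
    by_cases h : AEStronglyMeasurable (F k) μ
    · simp [F', h]
    · simp [F', h, integral_non_aestronglyMeasurable h]
  simp only [hint]
  rw [← integral_zero α ℝ (μ := μ)]
  refine tendsto_integral_of_dominated_convergence G (fun k => ?_) hG (fun k => ?_) ?_
  · by_cases h : AEStronglyMeasurable (F k) μ
    · simp only [F', if_pos h, h]
    · simp only [F', if_neg h]
      exact aestronglyMeasurable_zero
  · filter_upwards [hF k] with s hs using (hle k s).trans hs
  · filter_upwards [hlim] with s hs
    exact squeeze_zero_norm (fun k => hle k s) (by simpa using hs.abs)

theorem abs_integral_le_of_le_indicator {μ : Measure ℝ} {K : Set ℝ} (hK : IsCompact K)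
    (hμ : μ K < ⊤) {h : ℝ → ℝ} {A : ℝ} (hh : ∀ x, |h x| ≤ K.indicator (fun _ => A) x) :
    |∫ x, h x ∂μ| ≤ A * (μ K).toReal := by
  have hi : Integrable (K.indicator fun _ => A) μ :=
    (integrable_indicator_iff hK.measurableSet).2 (integrableOn_const hμ.ne)
  refine (norm_integral_le_of_norm_le (f := h) hi (Eventually.of_forall hh)).trans_eq ?_
  rw [integral_indicator hK.measurableSet, setIntegral_const, smul_eq_mul, mul_comm]
  rfl

theorem tendsto_integral_zero_of_le_indicator {μ : Measure ℝ} {K Z : Set ℝ} (hK : IsCompact K)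
    (hμ : μ K < ⊤) (hZ : μ Z = 0) {h : ℕ → ℝ → ℝ} {A : ℝ}
    (hh : ∀ k x, |h k x| ≤ K.indicator (fun _ => A) x)
    (hlim : ∀ x ∉ Z, Tendsto (fun k => h k x) atTop (𝓝 0)) :
    Tendsto (fun k => ∫ x, h k x ∂μ) atTop (𝓝 0) := by
  have hi : Integrable (K.indicator fun _ => A) μ :=
    (integrable_indicator_iff hK.measurableSet).2 (integrableOn_const hμ.ne)
  refine tendsto_integral_zero_of_dominated hi (fun k => Eventually.of_forall (hh k)) ?_
  filter_upwards [measure_eq_zero_iff_ae_notMem.1 hZ] with x hx using hlim x hx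

theorem tendsto_integral_sint1_zero {T t A : ℝ} {p n : ℝ → Measure ℝ}
    (hfam : IsLocFamily1 T p n) (ht : t ≤ T) {K Z : Set ℝ} (hK : IsCompact K)
    (hZ : ∀ᵐ s ∂(volume.restrict (Icc (0:ℝ) T)), (p s + n s) Z = 0) {h : ℕ → ℝ → ℝ → ℝ}
    (hh : ∀ k, ∀ s ∈ Icc 0 t, ∀ x, |h k s x| ≤ K.indicator (fun _ => A) x)
    (hlim : ∀ s ∈ Icc 0 t, ∀ x ∉ Z, Tendsto (fun k => h k s x) atTop (𝓝 0)) :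
    Tendsto (fun k => ∫ s in Icc (0:ℝ) t, sint1 p n s (h k s)) atTop (𝓝 0) := by
  have hsub : Icc (0:ℝ) t ⊆ Icc 0 T := Icc_subset_Icc_right ht
  have hfin := fun s (hs : s ∈ Icc 0 t) => hfam.1 s (hsub hs) K hK
  refine tendsto_integral_zero_of_dominated
    (((hfam.2.2.2 K hK).mono_set hsub).const_mul A) (fun k => ?_) ?_
  · filter_upwards [ae_restrict_mem measurableSet_Icc] with s hs
    rw [mul_add]
    exact (abs_sub _ _).trans (add_le_add
      (abs_integral_le_of_le_indicator hK (hfin s hs).1 (hh k s hs))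
      (abs_integral_le_of_le_indicator hK (hfin s hs).2 (hh k s hs)))
  · filter_upwards [ae_restrict_mem measurableSet_Icc, ae_restrict_of_ae_restrict_of_subset hsub hZ]
      with s hs hZs
    rw [Measure.add_apply, add_eq_zero] at hZs
    simpa [sint1] using
      (tendsto_integral_zero_of_le_indicator hK (hfin s hs).1 hZs.1 (fun k => hh k s hs)
        (hlim s hs)).sub
      (tendsto_integral_zero_of_le_indicator hK (hfin s hs).2 hZs.2 (fun k => hh k s hs)
        (hlim s hs))

theorem deriv_eq_zero_of_vanish {ψ : ℝ → ℝ} {R x : ℝ} (hψ : ∀ x, R < |x| → ψ x = 0)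
    (hx : R < |x|) : deriv ψ x = 0 := by
  have : ψ =ᶠ[𝓝 x] fun _ => 0 := by
    filter_upwards [(isOpen_lt continuous_const continuous_abs).mem_nhds hx] with y hy using hψ y hy
  rw [this.deriv_eq, deriv_const]

/-- A compactly supported `C¹` function carried backwards along a flow is, up to a cut-off away
from the relevant region, an admissible test function. -/
theorem IsFlow.exists_test_function {v : ℝ → ℝ} {X : ℝ → ℝ → ℝ} {L A C R T t₀ : ℝ}
    (hX : IsFlow v X) (hv : ContDiff ℝ 1 v) (hL : ∀ x, |deriv v x| ≤ L) (hR : 0 ≤ R)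
    (hA : 0 ≤ A) (hC : 0 ≤ C) (hgr : ∀ x, |v x| ≤ A + C * |x|) (ht₀ : t₀ ≤ T)
    {ψ : ℝ → ℝ} (hψ : ContDiff ℝ 1 ψ) (hψR : ∀ x, R < |x| → ψ x = 0) (b : ℝ → ℝ) :
    ∃ u : ℝ → ℝ → ℝ, ContDiff ℝ 1 (fun q : ℝ × ℝ => u q.1 q.2) ∧
      (∃ R > 0, ∀ x t, R < |x| → u x t = 0) ∧
      ∀ s ∈ Icc 0 t₀, ∀ x, u x s = ψ (X (t₀ - s) x) ∧
        deriv (u x) s + b x * deriv (fun y => u y s) x =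
          (b x - v x) * flowJac v X (t₀ - s) x * deriv ψ (X (t₀ - s) x) := by
  set R₁ := gronwallBound R C A T with hR₁
  have hfar : ∀ s ∈ Icc 0 t₀, ∀ x, R₁ < |x| → R < |X (t₀ - s) x| := fun s hs x hx => by
    by_contra! h
    exact absurd (hX.abs_le_gronwallBound hR hA hC hgr (sub_nonneg.2 hs.2)
      (by linarith [hs.1]) h) (not_le.2 hx)
  let χ : ContDiffBump (0:ℝ) :=
    { rIn := |R₁| + 1, rOut := |R₁| + 2, rIn_pos := by positivity, rIn_lt_rOut := by linarith }
  have hXs : ContDiff ℝ 1 fun q : ℝ × ℝ => X (t₀ - q.2) q.1 :=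
    (hX.contDiff hv hL).comp ((contDiff_const.sub contDiff_snd).prodMk contDiff_fst)
  have hev : ∀ s ∈ Icc 0 t₀, ∀ x, ∀ᶠ q in 𝓝 (x, s),
      χ q.1 * ψ (X (t₀ - q.2) q.1) = ψ (X (t₀ - q.2) q.1) := fun s hs x => by
    rcases le_or_gt |x| R₁ with h | h
    · have : {q : ℝ × ℝ | |q.1| < |R₁| + 1} ∈ 𝓝 (x, s) :=
        (isOpen_lt (by fun_prop) continuous_const).mem_nhds
          (by simpa using by linarith [le_abs_self R₁])
      filter_upwards [this] with q hq
      rw [χ.one_of_mem_closedBall (by simpa [χ] using (show |q.1| < _ from hq).le), one_mul]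
    · have : {q : ℝ × ℝ | R < |X (t₀ - q.2) q.1|} ∈ 𝓝 (x, s) :=
        (isOpen_lt continuous_const hXs.continuous.abs).mem_nhds (hfar s hs x h)
      filter_upwards [this] with q hq
      rw [hψR _ hq, mul_zero]
  refine ⟨fun x s => χ x * ψ (X (t₀ - s) x), ?_, ⟨|R₁| + 2, by positivity, fun x t hx => ?_⟩, ?_⟩
  · exact (χ.contDiff.comp contDiff_fst).mul (hψ.comp hXs)
  · have : χ x = 0 := χ.zero_of_le_dist (by simpa [χ] using hx.le)
    simp [this]
  · intro s hs x
    refine ⟨(hev s hs x).self_of_nhds, ?_⟩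
    have hc₁ : Tendsto (fun s' => (x, s')) (𝓝 s) (𝓝 (x, s)) := by
      exact (Continuous.prodMk_right x).tendsto s
    have hc₂ : Tendsto (fun x' => (x', s)) (𝓝 x) (𝓝 (x, s)) := by
      exact (Continuous.prodMk_left s).tendsto x
    have hd := (hψ.differentiable (by norm_num) (X (t₀ - s) x)).hasDerivAt
    have h₁ : deriv (fun s => χ x * ψ (X (t₀ - s) x)) s =
        deriv ψ (X (t₀ - s) x) * -(v (X (t₀ - s) x)) := by
      have he : (fun s => χ x * ψ (X (t₀ - s) x)) =ᶠ[𝓝 s] fun s => ψ (X (t₀ - s) x) :=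
        hc₁.eventually (hev s hs x)
      rw [he.deriv_eq]
      exact (hd.comp s ((hX.2 (t₀ - s) x).comp_const_sub t₀ s)).deriv
    have h₂ : deriv (fun y => χ y * ψ (X (t₀ - s) y)) x =
        deriv ψ (X (t₀ - s) x) * flowJac v X (t₀ - s) x := by
      have he : (fun y => χ y * ψ (X (t₀ - s) y)) =ᶠ[𝓝 x] fun y => ψ (X (t₀ - s) y) :=
        hc₂.eventually (hev s hs x)
      rw [he.deriv_eq]
      exact (hd.comp x (hX.hasDerivAt_space hv hL (t₀ - s) x)).deriv
    rw [h₁, h₂, hX.map_eq hv]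
    ring

end Duality

section Uniqueness

theorem IsLocFamily1.isFiniteMeasureOnCompacts {T t : ℝ} {p n : ℝ → Measure ℝ}
    (h : IsLocFamily1 T p n) (ht : t ∈ Icc 0 T) :
    IsFiniteMeasureOnCompacts (p t) ∧ IsFiniteMeasureOnCompacts (n t) :=
  ⟨⟨fun K hK => (h.1 t ht K hK).1⟩, ⟨fun K hK => (h.1 t ht K hK).2⟩⟩

theorem IsLocFamily1.abs_sint1_sub_le {T t A : ℝ} {p n : ℝ → Measure ℝ}
    (h : IsLocFamily1 T p n) (ht : t ∈ Icc 0 T) {K : Set ℝ} (hK : IsCompact K) {φ ψ : ℝ → ℝ}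
    (hφ : Continuous φ) (hψ : Continuous ψ) (hφK : ∀ x ∉ K, φ x = 0) (hψK : ∀ x ∉ K, ψ x = 0)
    (hA : ∀ x, |φ x - ψ x| ≤ A) :
    |sint1 p n t φ - sint1 p n t ψ| ≤ A * ((p t K).toReal + (n t K).toReal) := by
  obtain ⟨_, _⟩ := h.isFiniteMeasureOnCompacts ht
  have hle : ∀ x, |φ x - ψ x| ≤ K.indicator (fun _ => A) x := fun x => by
    by_cases hx : x ∈ K
    · simpa [hx] using hA x
    · simp [hx, hφK, hψK]
  have hi : ∀ (μ : Measure ℝ) [IsFiniteMeasureOnCompacts μ], Integrable φ μ ∧ Integrable ψ μ :=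
    fun μ _ => ⟨hφ.integrable_of_hasCompactSupport (HasCompactSupport.intro hK hφK),
      hψ.integrable_of_hasCompactSupport (HasCompactSupport.intro hK hψK)⟩
  have e : sint1 p n t φ - sint1 p n t ψ = (∫ x, φ x - ψ x ∂p t) - ∫ x, φ x - ψ x ∂n t := by
    rw [integral_sub (hi _).1 (hi _).2, integral_sub (hi _).1 (hi _).2]
    simp only [sint1]
    ring
  rw [e, mul_add]
  exact (abs_sub _ _).trans (add_le_add
    (abs_integral_le_of_le_indicator hK (h.1 t ht K hK).1 hle)
    (abs_integral_le_of_le_indicator hK (h.1 t ht K hK).2 hle))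

theorem abs_coe_projIcc_le {R : ℝ} (h : -R ≤ R) (x : ℝ) : |(projIcc (-R) R h x : ℝ)| ≤ |x| := by
  rw [coe_projIcc]
  rcases le_total R x with h1 | h1 <;> rcases le_total (-R) x with h2 | h2 <;>
    rcases le_total 0 x with h3 | h3 <;>
    simp only [min_eq_left, min_eq_right, max_eq_right, h1, h2, h, le_refl, max_eq_left,
      abs_of_nonneg, abs_of_nonpos, h3] <;>
    exact abs_le.2 ⟨by linarith, by linarith⟩

variable {T C R : ℝ} {Λ : NNReal} {b g f : ℝ → ℝ} {νp νn : Measure ℝ}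
  {p₁ n₁ p₂ n₂ : ℝ → Measure ℝ}

theorem exists_approx_flows_Icc (hb : Continuous b) (hC : 0 ≤ C)
    (hgrowth : ∀ x, |b x| ≤ C + C * |x|) (hsum : ∀ x, b x = g x + f x) (hf0 : ∀ x, 0 ≤ f x)
    (hg : LipschitzWith Λ g) (hsign : ∀ x, g x < 0 → f x = 0) (T : ℝ) (hR : 0 ≤ R) :
    ∃ (v : ℕ → ℝ → ℝ) (X : ℕ → ℝ → ℝ → ℝ) (A M : ℝ),
      (∀ k, ContDiff ℝ 1 (v k)) ∧ (∀ k, ∃ K, ∀ x, |deriv (v k) x| ≤ K) ∧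
      (∀ k, IsFlow (v k) (X k)) ∧ (∀ k x, |v k x| ≤ C + 1 + C * |x|) ∧ (∀ k x, |v k x| ≤ M) ∧
      (∀ k, ∀ t ∈ Icc 0 T, ∀ x ∈ Icc (-R) R, |b x - v k x| * flowJac (v k) (X k) t x ≤ A) ∧
      ∀ t ∈ Icc 0 T, ∀ x ∈ Icc (-R) R, x ∉ frontier {x | f x = 0} →
        Tendsto (fun k => |b x - v k x| * flowJac (v k) (X k) t x) atTop (𝓝 0) := by
  have hR' : -R ≤ R := by linarith
  let π : ℝ → ℝ := fun x => projIcc (-R) R hR' x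
  have hπ : LipschitzWith 1 π := by
    have := (LipschitzWith.subtype_val (Icc (-R) R)).comp (LipschitzWith.projIcc hR')
    rwa [one_mul] at this
  have hπR : ∀ x, |π x| ≤ R := fun x => abs_le.2 (projIcc (-R) R hR' x).2
  have hπx : ∀ x ∈ Icc (-R) R, π x = x := fun x hx => by
    simp only [π, projIcc_of_mem hR' hx]
  have hbu : UniformContinuous (b ∘ π) :=
    (CompactSpace.uniformContinuous_of_continuous
      (hb.comp continuous_subtype_val : Continuous fun y : Icc (-R) R => b y)).comp
      (LipschitzWith.projIcc hR').uniformContinuous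
  have hbM : ∀ x, |(b ∘ π) x| ≤ C + C * R := fun x =>
    (hgrowth _).trans (by gcongr; exact hπR x)
  obtain ⟨v, X, A, hv, hK, hX, hclose, hbd, hlim⟩ := exists_approx_flows (T := T) hbu hbM
    (fun x => hsum (π x)) (fun x => hf0 (π x)) (hg.comp hπ) (fun x => hsign (π x))
  have hvb : ∀ k x, |v k x| ≤ 1 + |b (π x)| := fun k x => by
    have := abs_add_le (v k x - b (π x)) (b (π x))
    rw [sub_add_cancel] at this
    exact this.trans (add_le_add_left (hclose k x) _)
  refine ⟨v, X, A, C + C * R + 1, hv, hK, hX, fun k x => ?_, fun k x => ?_, fun k t ht x hx => ?_,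
    fun t ht x hx hxf => ?_⟩
  · have h1 : C * |π x| ≤ C * |x| := mul_le_mul_of_nonneg_left (abs_coe_projIcc_le hR' x) hC
    linarith [hvb k x, hgrowth (π x)]
  · have : |b (π x)| ≤ C + C * R := hbM x
    linarith [hvb k x]
  · simpa [hπx x hx] using hbd k t ht x
  · have := hlim t ht x ?_
    · simpa [hπx x hx] using this
    · simp only [hπx x hx]
      rw [or_iff_not_imp_left, not_not]
      intro h
      by_contra hne
      refine hxf ⟨subset_closure h, fun hint => hne ?_⟩
      have hc : Tendsto π (𝓝 x) (𝓝 x) := by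
        simpa only [hπx x hx] using hπ.continuous.tendsto x
      exact hc.eventually (mem_interior_iff_mem_nhds.1 hint)

theorem ae_sint1_eq_of_contDiff (hb : Continuous b) (hC : 0 ≤ C)
    (hgrowth : ∀ x, |b x| ≤ C + C * |x|) (hsum : ∀ x, b x = g x + f x) (hf0 : ∀ x, 0 ≤ f x)
    (hg : LipschitzWith Λ g) (hsign : ∀ x, g x < 0 → f x = 0) (hT : 0 ≤ T)
    (hfam₁ : IsLocFamily1 T p₁ n₁) (hfam₂ : IsLocFamily1 T p₂ n₂)
    (hsol₁ : IsSolution1 T b νp νn p₁ n₁) (hsol₂ : IsSolution1 T b νp νn p₂ n₂)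
    (hZ₁ : ∀ᵐ t ∂(volume.restrict (Icc (0:ℝ) T)),
      (p₁ t + n₁ t) (frontier {x : ℝ | f x = 0}) = 0)
    (hZ₂ : ∀ᵐ t ∂(volume.restrict (Icc (0:ℝ) T)),
      (p₂ t + n₂ t) (frontier {x : ℝ | f x = 0}) = 0)
    (hR : 0 ≤ R) {ψ : ℝ → ℝ} (hψ : ContDiff ℝ 1 ψ) (hψR : ∀ x, R < |x| → ψ x = 0) :
    ∀ᵐ t ∂(volume.restrict (Icc (0:ℝ) T)), sint1 p₁ n₁ t ψ = sint1 p₂ n₂ t ψ := by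
  set R₁ := gronwallBound R C (C + 1) T with hR₁def
  have hC1 : 0 ≤ C + 1 := by linarith
  have hRR₁ : R ≤ R₁ := by
    have := gronwallBound_mono hR hC1 hC hT
    rwa [gronwallBound_x0] at this
  have hR₁ : 0 ≤ R₁ := hR.trans hRR₁
  obtain ⟨v, X, A, M, hv, hL, hX, hgr, hM, hbd, hlim⟩ :=
    exists_approx_flows_Icc hb hC hgrowth hsum hf0 hg hsign T hR₁
  choose L hL using hL
  have hdc : Continuous (deriv ψ) := hψ.continuous_deriv le_rfl
  obtain ⟨D, hD⟩ : ∃ D, ∀ x, |deriv ψ x| ≤ D :=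
    hdc.bounded_above_of_compact_support
      (HasCompactSupport.intro (isCompact_Icc (a := -R) (b := R)) fun x hx =>
        deriv_eq_zero_of_vanish hψR (by contrapose! hx; exact abs_le.1 hx))
  have hD0 : 0 ≤ D := (abs_nonneg _).trans (hD 0)
  have hlip : ∀ x y, |ψ y - ψ x| ≤ D * |y - x| := fun x y =>
    Convex.norm_image_sub_le_of_norm_deriv_le (s := univ)
      (fun z _ => hψ.differentiable (by norm_num) z) (fun z _ => hD z) convex_univ trivial trivial
  have hfar : ∀ k t x, 0 ≤ t → t ≤ T → x ∉ Icc (-R₁) R₁ → R < |X k t x| := fun k t x h0 h1 hx => by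
    by_contra! h
    exact hx (abs_le.1 ((hX k).abs_le_gronwallBound hR hC1 hC (hgr k) h0 h1 h))
  have hout : ∀ x ∉ Icc (-R₁) R₁, ψ x = 0 := fun x hx => hψR x <| by
    contrapose! hx
    exact abs_le.1 (hx.trans hRR₁)
  have htest := fun (k : ℕ) (q : {q : ℚ // (q:ℝ) ≤ T}) =>
    (hX k).exists_test_function (hv k) (hL k) hR hC1 hC (hgr k) q.2 hψ hψR b
  choose u hu hu0 hus using htest
  have hJ : ∀ {p n : ℝ → Measure ℝ}, IsLocFamily1 T p n →
      (∀ᵐ t ∂(volume.restrict (Icc (0:ℝ) T)), (p t + n t) (frontier {x : ℝ | f x = 0}) = 0) →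
      ∀ (q : {q : ℚ // (q:ℝ) ≤ T}) (t : ℝ), t ≤ (q.1 : ℝ) →
      Tendsto (fun k => ∫ s in Icc (0:ℝ) t, sint1 p n s
        (fun x => deriv (u k q x) s + b x * deriv (fun y => u k q y s) x)) atTop (𝓝 0) := by
    intro p n hfam hZ q t htq
    have hmem : ∀ s ∈ Icc (0:ℝ) t, s ∈ Icc (0:ℝ) q.1 ∧ (q.1:ℝ) - s ∈ Icc 0 T := fun s hs =>
      ⟨⟨hs.1, hs.2.trans htq⟩, by linarith [hs.2], by linarith [hs.1, q.2]⟩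
    refine tendsto_integral_sint1_zero (A := A * D) hfam (htq.trans q.2)
      (isCompact_Icc (a := -R₁) (b := R₁)) hZ (fun k s hs x => ?_) (fun s hs x hx => ?_)
    · obtain ⟨hs1, hs2⟩ := hmem s hs
      rw [(hus k q s hs1 x).2]
      by_cases hxR : x ∈ Icc (-R₁) R₁
      · rw [indicator_of_mem hxR, abs_mul, abs_mul, abs_of_pos (flowJac_pos _ _ _ _)]
        have := hbd k _ hs2 x hxR
        exact mul_le_mul this (hD _) (abs_nonneg _)
          ((mul_nonneg (abs_nonneg _) (flowJac_pos _ _ _ _).le).trans this)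
      · rw [indicator_of_notMem hxR, deriv_eq_zero_of_vanish hψR (hfar k _ x hs2.1 hs2.2 hxR)]
        simp
    · obtain ⟨hs1, hs2⟩ := hmem s hs
      simp only [fun k => (hus k q s hs1 x).2]
      by_cases hxR : x ∈ Icc (-R₁) R₁
      · refine squeeze_zero_norm (fun k => ?_)
          (by simpa using (hlim _ hs2 x hxR hx).mul_const D)
        rw [Real.norm_eq_abs, abs_mul, abs_mul, abs_of_pos (flowJac_pos _ _ _ _)]
        exact mul_le_mul_of_nonneg_left (hD _)
          (mul_nonneg (abs_nonneg _) (flowJac_pos _ _ _ _).le)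
      · simp [deriv_eq_zero_of_vanish hψR (hfar _ _ x hs2.1 hs2.2 hxR)]
  have hne : ∀ᵐ t ∂(volume.restrict (Icc (0:ℝ) T)), t ≠ T :=
    ae_restrict_of_ae (Measure.ae_ne volume T)
  filter_upwards [ae_all_iff.2 fun k => ae_all_iff.2 fun q => hsol₁.2 (u k q) (hu k q) (hu0 k q),
    ae_all_iff.2 fun k => ae_all_iff.2 fun q => hsol₂.2 (u k q) (hu k q) (hu0 k q),
    ae_restrict_mem measurableSet_Icc, hne] with t h₁ h₂ ht htne
  have htT : t < T := lt_of_le_of_ne ht.2 htne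
  have hclose : ∀ {p n : ℝ → Measure ℝ}, IsLocFamily1 T p n → ∀ k (q : {q : ℚ // (q:ℝ) ≤ T}),
      t ≤ (q.1:ℝ) → |sint1 p n t (fun x => u k q x t) - sint1 p n t ψ| ≤
        D * (M * (q.1 - t)) * ((p t (Icc (-R₁) R₁)).toReal + (n t (Icc (-R₁) R₁)).toReal) := by
    intro p n hfam k q htq
    have hut : (fun x => u k q x t) = fun x => ψ (X k (q.1 - t) x) :=
      funext fun x => (hus k q t ⟨ht.1, htq⟩ x).1
    rw [hut]
    refine hfam.abs_sint1_sub_le ht isCompact_Icc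
      (hψ.continuous.comp (((hX k).continuous (hv k) (hL k)).comp (Continuous.prodMk_right _)))
      hψ.continuous (fun x hx => hψR _ (hfar k _ x (sub_nonneg.2 htq) (by linarith [q.2, ht.1]) hx))
      hout fun x => (hlip _ _).trans (mul_le_mul_of_nonneg_left ?_ hD0)
    have := (hX k).abs_sub_time_le (hM k) x 0 (q.1 - t)
    rwa [(hX k).1, sub_zero, abs_of_nonneg (sub_nonneg.2 htq)] at this
  set m := ((p₁ t (Icc (-R₁) R₁)).toReal + (n₁ t (Icc (-R₁) R₁)).toReal) +
    ((p₂ t (Icc (-R₁) R₁)).toReal + (n₂ t (Icc (-R₁) R₁)).toReal) with hm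
  have hq : ∀ q : {q : ℚ // (q:ℝ) ≤ T}, t ≤ (q.1:ℝ) →
      |sint1 p₁ n₁ t ψ - sint1 p₂ n₂ t ψ| ≤ D * (M * (q.1 - t)) * m := by
    intro q htq
    have hlimJ := ((hJ hfam₁ hZ₁ q t htq).sub (hJ hfam₂ hZ₂ q t htq)).abs.add_const
      (D * (M * (q.1 - t)) * m)
    rw [sub_zero, abs_zero, zero_add] at hlimJ
    refine ge_of_tendsto hlimJ (Eventually.of_forall fun k => ?_)
    have e₁ := h₁ k q
    have e₂ := h₂ k q
    have c₁ := hclose hfam₁ k q htq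
    have c₂ := hclose hfam₂ k q htq
    rw [e₁] at c₁
    rw [e₂] at c₂
    rw [hm, mul_add]
    generalize (∫ s in Icc (0:ℝ) t, sint1 p₁ n₁ s
        (fun x => deriv (u k q x) s + b x * deriv (fun y => u k q y s) x)) = J₁ at *
    generalize (∫ s in Icc (0:ℝ) t, sint1 p₂ n₂ s
        (fun x => deriv (u k q x) s + b x * deriv (fun y => u k q y s) x)) = J₂ at *
    have := le_abs_self (J₁ - J₂)
    have := neg_abs_le (J₁ - J₂)
    rw [abs_le] at *
    constructor <;> linarith
  have hzero : |sint1 p₁ n₁ t ψ - sint1 p₂ n₂ t ψ| ≤ 0 := by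
    have hc : Tendsto (fun r : ℝ => D * (M * (r - t)) * m) (𝓝[>] t) (𝓝 0) := by
      have : Continuous fun r : ℝ => D * (M * (r - t)) * m := by fun_prop
      simpa using (this.tendsto t).mono_left nhdsWithin_le_nhds
    refine le_of_forall_pos_le_add fun ε hε => ?_
    obtain ⟨r, hr, hsub⟩ := mem_nhdsGT_iff_exists_Ioo_subset.1
      (hc.eventually (gt_mem_nhds hε))
    obtain ⟨q, hq1, hq2⟩ := exists_rat_btwn (lt_min (show t < r from hr) htT)
    have h3 : D * (M * ((q:ℝ) - t)) * m < ε := hsub ⟨hq1, hq2.trans_le (min_le_left _ _)⟩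
    linarith [hq ⟨q, (hq2.trans_le (min_le_right _ _)).le⟩ hq1.le]
  exact sub_eq_zero.1 (abs_nonpos_iff.1 hzero)

/-- Smooth functions supported in `[a, b]` increasing to the indicator of `(a, b)`. -/
def smoothBump (a b : ℝ) (j : ℕ) (x : ℝ) : ℝ :=
  Real.smoothTransition (j * (x - a)) * Real.smoothTransition (j * (b - x))

theorem contDiff_smoothBump (a b : ℝ) (j : ℕ) : ContDiff ℝ 1 (smoothBump a b j) :=
  (Real.smoothTransition.contDiff.comp (contDiff_const.mul (contDiff_id.sub contDiff_const))).mul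
    (Real.smoothTransition.contDiff.comp (contDiff_const.mul (contDiff_const.sub contDiff_id)))

theorem smoothBump_eq_zero {a b x : ℝ} (j : ℕ) (hx : x ∉ Ioo a b) : smoothBump a b j x = 0 := by
  rw [mem_Ioo, not_and_or, not_lt, not_lt] at hx
  rcases hx with hx | hx
  · rw [smoothBump, Real.smoothTransition.zero_of_nonpos
      (mul_nonpos_of_nonneg_of_nonpos j.cast_nonneg (by linarith)), zero_mul]
  · rw [smoothBump, Real.smoothTransition.zero_of_nonpos (x := j * (b - x))
      (mul_nonpos_of_nonneg_of_nonpos j.cast_nonneg (by linarith)), mul_zero]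

theorem abs_smoothBump_le (a b : ℝ) (j : ℕ) (x : ℝ) :
    |smoothBump a b j x| ≤ (Icc a b).indicator (fun _ => 1) x := by
  by_cases hx : x ∈ Ioo a b
  · rw [indicator_of_mem (Ioo_subset_Icc_self hx), smoothBump, abs_of_nonneg
      (mul_nonneg (Real.smoothTransition.nonneg _) (Real.smoothTransition.nonneg _))]
    exact mul_le_one₀ (Real.smoothTransition.le_one _) (Real.smoothTransition.nonneg _)
      (Real.smoothTransition.le_one _)
  · rw [smoothBump_eq_zero j hx, abs_zero]
    exact indicator_nonneg (fun _ _ => zero_le_one) x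

theorem tendsto_smoothBump (a b x : ℝ) :
    Tendsto (fun j => smoothBump a b j x) atTop (𝓝 ((Ioo a b).indicator (fun _ => 1) x)) := by
  by_cases hx : x ∈ Ioo a b
  · rw [indicator_of_mem hx]
    refine tendsto_const_nhds.congr' ?_
    have h : ∀ c : ℝ, 0 < c → ∀ᶠ j : ℕ in atTop, 1 ≤ j * c := fun c hc =>
      (tendsto_natCast_atTop_atTop.atTop_mul_const hc).eventually_ge_atTop 1
    filter_upwards [h (x - a) (sub_pos.2 hx.1), h (b - x) (sub_pos.2 hx.2)] with j h1 h2
    rw [smoothBump, Real.smoothTransition.one_of_one_le h1,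
      Real.smoothTransition.one_of_one_le h2, one_mul]
  · simp [indicator_of_notMem hx, smoothBump_eq_zero _ hx]

theorem tendsto_integral_smoothBump (μ : Measure ℝ) [IsFiniteMeasureOnCompacts μ] (a b : ℝ) :
    Tendsto (fun j => ∫ x, smoothBump a b j x ∂μ) atTop (𝓝 (μ (Ioo a b)).toReal) := by
  have hi : Integrable ((Icc a b).indicator fun _ => (1:ℝ)) μ :=
    (integrable_indicator_iff measurableSet_Icc).2
      (integrableOn_const isCompact_Icc.measure_lt_top.ne)
  have := tendsto_integral_of_dominated_convergence (F := fun j x => smoothBump a b j x) _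
    (fun j => (contDiff_smoothBump a b j).continuous.aestronglyMeasurable) hi
    (fun j => Eventually.of_forall (abs_smoothBump_le a b j))
    (Eventually.of_forall (tendsto_smoothBump a b))
  rw [integral_indicator measurableSet_Ioo] at this
  simpa [Measure.real] using this

end Uniqueness

/-- **Corollary 2.** Let `b ∈ C(ℝ)` with `|b(x)| ≤ C + C|x|` and `b = g + f`,
where `f ≥ 0`, `g` is Lipschitz with constant `Λ`, and `g(x) < 0 ⟹ f(x) = 0`.
Then the Cauchy problem `∂_t μ + ∂_x (b μ) = 0`, `μ|_{t=0} = ν` has at most one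
solution in the class of all locally bounded measures given by families
`(μ_t)_{t∈[0,T]}` with `|μ_t|(∂Z_f) = 0` for a.e. `t`, where `Z_f = {x : f(x) = 0}`. -/
theorem uniqueness_dim_one_lipschitz_plus_nonneg
    (T : ℝ) (hT : 0 < T)
    (b g f : ℝ → ℝ) (hb : Continuous b)
    (C : ℝ) (hC : 0 < C) (hgrowth : ∀ x, |b x| ≤ C + C * |x|)
    (hsum : ∀ x, b x = g x + f x)
    (hf0 : ∀ x, 0 ≤ f x)
    (Λ : NNReal) (hg : LipschitzWith Λ g)
    (hsign : ∀ x, g x < 0 → f x = 0)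
    (νp νn : Measure ℝ) (hν : ∀ K : Set ℝ, IsCompact K → νp K < ⊤ ∧ νn K < ⊤)
    (p₁ n₁ p₂ n₂ : ℝ → Measure ℝ)
    (hfam₁ : IsLocFamily1 T p₁ n₁) (hfam₂ : IsLocFamily1 T p₂ n₂)
    (hsol₁ : IsSolution1 T b νp νn p₁ n₁) (hsol₂ : IsSolution1 T b νp νn p₂ n₂)
    (hZ₁ : ∀ᵐ t ∂(volume.restrict (Icc (0:ℝ) T)),
      (p₁ t + n₁ t) (frontier {x : ℝ | f x = 0}) = 0)
    (hZ₂ : ∀ᵐ t ∂(volume.restrict (Icc (0:ℝ) T)),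
      (p₂ t + n₂ t) (frontier {x : ℝ | f x = 0}) = 0) :
    ∀ᵐ t ∂(volume.restrict (Icc (0:ℝ) T)), p₁ t + n₂ t = p₂ t + n₁ t := by
  have hae := ae_all_iff.2 fun a : ℚ => ae_all_iff.2 fun c : ℚ => ae_all_iff.2 fun j : ℕ =>
    ae_sint1_eq_of_contDiff hb hC.le hgrowth hsum hf0 hg hsign hT.le hfam₁ hfam₂ hsol₁ hsol₂
      hZ₁ hZ₂ (R := max |(a:ℝ)| |(c:ℝ)|) (le_max_of_le_left (abs_nonneg _))
      (contDiff_smoothBump a c j) fun x hx => smoothBump_eq_zero j fun h =>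
        absurd (abs_le_max_abs_abs h.1.le h.2.le) (not_le.2 hx)
  filter_upwards [hae, ae_restrict_mem measurableSet_Icc] with t h ht
  obtain ⟨_, _⟩ := hfam₁.isFiniteMeasureOnCompacts ht
  obtain ⟨_, _⟩ := hfam₂.isFiniteMeasureOnCompacts ht
  have : IsFiniteMeasureOnCompacts (p₁ t + n₂ t) := ⟨fun K hK => by
    rw [Measure.add_apply]
    exact ENNReal.add_lt_top.2 ⟨hK.measure_lt_top, hK.measure_lt_top⟩⟩
  have : IsLocallyFiniteMeasure (p₁ t + n₂ t) :=
    isLocallyFiniteMeasure_of_isFiniteMeasureOnCompacts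
  refine Real.measure_ext_Ioo_rat fun a c => ?_
  have hlim := tendsto_nhds_unique
    (((tendsto_integral_smoothBump (p₁ t) a c).sub (tendsto_integral_smoothBump (n₁ t) a c)).congr
      fun j => h a c j)
    ((tendsto_integral_smoothBump (p₂ t) a c).sub (tendsto_integral_smoothBump (n₂ t) a c))
  have hfin : ∀ (μ : Measure ℝ) [IsFiniteMeasureOnCompacts μ], μ (Ioo (a:ℝ) c) ≠ ⊤ := fun μ _ =>
    ((measure_mono Ioo_subset_Icc_self).trans_lt isCompact_Icc.measure_lt_top).ne
  rw [Measure.add_apply, Measure.add_apply,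
    ← ENNReal.toReal_eq_toReal_iff' (ENNReal.add_ne_top.2 ⟨hfin _, hfin _⟩)
      (ENNReal.add_ne_top.2 ⟨hfin _, hfin _⟩),
    ENNReal.toReal_add (hfin _) (hfin _), ENNReal.toReal_add (hfin _) (hfin _)]
  linarith
end
end

section
/- Assume that b ∈ C(ℝ^d × ℝ, ℝ^d) and there exist numbers C₁, C₂, C₃ such that |b(x,t)| ≤ C₁ + C₂|x| and ⟨b(x+ξ,t) − b(x,t), ξ⟩ ≤ C₃|ξ|² for all (x,t) ∈ ℝ^d × [0,T] and every ξ ∈ ℝ^d. Then for every locally bounded Borel measure ν on ℝ^d there exists at most one solution of the Cauchy problem ∂_t μ + div(b μ) = 0, μ|_{t=0} = ν in the class of all locally bounded measures μ given by families of locally bounded measures (μ_t)_{t∈[0,T]}. -/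
open MeasureTheory Metric Set Filter
open scoped Topology ENNReal RealInnerProductSpace

noncomputable section

/-- The total variation measure `|a - b|` of the (formal) difference of two
locally finite nonnegative measures, defined via measure subtraction. -/
def tvDiff {α : Type*} [MeasurableSpace α] (a b : Measure α) : Measure α :=
  (a - b) + (b - a)

/-- A family `(μ_t)_{t∈[0,T]}` of locally bounded signed Borel measures on `ℝ^d`,
represented by its Jordan decomposition `μ_t = p t - n t`:  each `p t`, `n t` is
finite on compact sets and they are mutually singular, `t ↦ μ_t(B)` is measurable
for bounded Borel `B`, and `t ↦ |μ_t|(K)` is in `L¹[0,T]` for every compact `K`. -/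
def IsLocFamily {d : ℕ} (T : ℝ)
    (p n : ℝ → Measure (EuclideanSpace ℝ (Fin d))) : Prop :=
  (∀ t ∈ Icc (0:ℝ) T, ∀ K : Set (EuclideanSpace ℝ (Fin d)), IsCompact K →
      p t K < ⊤ ∧ n t K < ⊤) ∧
  (∀ t ∈ Icc (0:ℝ) T, p t ⟂ₘ n t) ∧
  (∀ B : Set (EuclideanSpace ℝ (Fin d)), MeasurableSet B → Bornology.IsBounded B →
      Measurable (fun t => p t B) ∧ Measurable (fun t => n t B)) ∧
  (∀ K : Set (EuclideanSpace ℝ (Fin d)), IsCompact K →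
      IntegrableOn (fun t => (p t K).toReal + (n t K).toReal) (Icc (0:ℝ) T))

/-- Integral of `f` against the signed measure `μ_t = p t - n t`. -/
def sint {d : ℕ} (p n : ℝ → Measure (EuclideanSpace ℝ (Fin d))) (t : ℝ)
    (f : EuclideanSpace ℝ (Fin d) → ℝ) : ℝ :=
  (∫ x, f x ∂(p t)) - ∫ x, f x ∂(n t)

/-- The family `μ_t = p t - n t` is a solution of the Cauchy problem
`∂_t μ + div (b μ) = 0`, `μ|_{t=0} = ν` (`ν = νp - νn`) on `[0,T]`:
`b` is `|μ|`-integrable on `U × [0,T]` for every ball `U` and the weak identity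
`∫ u(x,t) μ_t(dx) = ∫ u(x,0) ν(dx) + ∫₀ᵗ ∫ [∂_t u + ⟨b,∇u⟩] μ_s(dx) ds`
holds for a.e. `t ∈ [0,T]`, for every `C¹` test function `u` vanishing for
`|x| > R` for some `R`. -/
def IsSolution {d : ℕ} (T : ℝ)
    (b : EuclideanSpace ℝ (Fin d) → ℝ → EuclideanSpace ℝ (Fin d))
    (νp νn : Measure (EuclideanSpace ℝ (Fin d)))
    (p n : ℝ → Measure (EuclideanSpace ℝ (Fin d))) : Prop :=
  (∀ (x₀ : EuclideanSpace ℝ (Fin d)) (R : ℝ), 0 < R →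
      (∫⁻ t in Icc (0:ℝ) T,
        ∫⁻ x in ball x₀ R, ENNReal.ofReal ‖b x t‖ ∂(p t + n t)) < ⊤) ∧
  ∀ u : EuclideanSpace ℝ (Fin d) → ℝ → ℝ,
    ContDiff ℝ 1 (fun q : EuclideanSpace ℝ (Fin d) × ℝ => u q.1 q.2) →
    (∃ R > 0, ∀ x t, R < ‖x‖ → u x t = 0) →
    ∀ᵐ t ∂(volume.restrict (Icc (0:ℝ) T)),
      sint p n t (fun x => u x t)
        = ((∫ x, u x 0 ∂νp) - ∫ x, u x 0 ∂νn)
          + ∫ s in Icc (0:ℝ) t,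
              sint p n s (fun x => deriv (u x) s
                + ⟪b x s, gradient (fun y => u y s) x⟫)

/-- If `t ↦ μ_t(B)` is measurable for bounded Borel sets `B`, then integrating a jointly continuous
function supported in a fixed ball against `μ_t` depends measurably on `t`. -/
lemma aestronglyMeasurable_integral_family {E : Type*} [NormedAddCommGroup E]
    [SecondCountableTopology E] [MeasurableSpace E] [BorelSpace E] {p : ℝ → Measure E}
    (hp : ∀ B : Set E, MeasurableSet B → Bornology.IsBounded B → Measurable (fun t => p t B))
    {f : E → ℝ → ℝ} (hf : Continuous (fun q : E × ℝ => f q.1 q.2)) {R : ℝ}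
    (hR : ∀ x t, R < ‖x‖ → f x t = 0) {s : Set ℝ}
    (hs : ∀ t ∈ s, p t (closedBall 0 R) ≠ ⊤) (hms : MeasurableSet s) :
    AEStronglyMeasurable (fun t => ∫ x, f x t ∂(p t)) (volume.restrict s) := by
  set B : Set E := closedBall 0 R with hB
  have hBm : MeasurableSet B := measurableSet_closedBall
  have hpB : Measurable (fun t => p t B) := hp B hBm isBounded_closedBall
  let κ : ProbabilityTheory.Kernel ℝ E :=
    { toFun := fun t => (p t B)⁻¹ • (p t).restrict B
      measurable' := by
        refine Measure.measurable_of_measurable_coe _ fun A hA => ?_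
        simp only [Measure.smul_apply, smul_eq_mul, Measure.restrict_apply hA]
        exact hpB.inv.mul (hp _ (hA.inter hBm) (isBounded_closedBall.subset inter_subset_right)) }
  have hκ : ∀ t, κ t = (p t B)⁻¹ • (p t).restrict B := fun t => rfl
  have : ProbabilityTheory.IsFiniteKernel κ := by
    refine ⟨⟨1, ENNReal.one_lt_top, fun t => ?_⟩⟩
    simp only [hκ, Measure.smul_apply, smul_eq_mul, Measure.restrict_apply MeasurableSet.univ,
      univ_inter]
    exact ENNReal.inv_mul_le_one _
  have hmeas : StronglyMeasurable (fun t => (p t B).toReal * ∫ x, f x t ∂(κ t)) := by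
    refine hpB.ennreal_toReal.stronglyMeasurable.mul ?_
    have hc : Continuous (fun q : ℝ × E => f q.2 q.1) := hf.comp continuous_swap
    exact MeasureTheory.StronglyMeasurable.integral_kernel_prod_right'
      (f := fun q : ℝ × E => f q.2 q.1) hc.stronglyMeasurable
  refine hmeas.aestronglyMeasurable.congr ?_
  filter_upwards [ae_restrict_mem hms] with t ht
  have h1 : ∫ x, f x t ∂(p t) = ∫ x in B, f x t ∂(p t) := by
    refine (setIntegral_eq_integral_of_forall_compl_eq_zero fun x hx => hR x t ?_).symm
    simpa [hB] using hx
  rw [h1, hκ, integral_smul_measure, smul_eq_mul, ENNReal.toReal_inv, ← mul_assoc]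
  by_cases h0 : p t B = 0
  · simp [Measure.restrict_eq_zero.2 h0]
  · rw [mul_inv_cancel₀ (ENNReal.toReal_ne_zero.2 ⟨h0, hs t ht⟩), one_mul]

lemma abs_integral_le_of_support_ball {E : Type*} [NormedAddCommGroup E]
    [MeasurableSpace E] [BorelSpace E] {μ : Measure E} {f : E → ℝ} {R c : ℝ}
    (hR : ∀ x, R < ‖x‖ → f x = 0) (hc : ∀ x, |f x| ≤ c) (hμ : μ (closedBall 0 R) < ⊤) :
    |∫ x, f x ∂μ| ≤ c * (μ (closedBall 0 R)).toReal := by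
  rw [← setIntegral_eq_integral_of_forall_compl_eq_zero (s := closedBall 0 R)
    fun x hx => hR x (by simpa using hx)]
  exact norm_setIntegral_le_of_norm_le_const (f := f) hμ fun x _ => hc x

/-- A jointly continuous function supported in a fixed ball is integrated against `μ_t` to an
integrable function of `t`. -/
lemma integrableOn_integral_family {E : Type*} [NormedAddCommGroup E] [ProperSpace E]
    [MeasurableSpace E] [BorelSpace E] {p : ℝ → Measure E} {T : ℝ}
    (hfin : ∀ t ∈ Icc (0:ℝ) T, ∀ K : Set E, IsCompact K → p t K < ⊤)
    (hp : ∀ B : Set E, MeasurableSet B → Bornology.IsBounded B → Measurable (fun t => p t B))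
    (hint : ∀ K : Set E, IsCompact K → IntegrableOn (fun t => (p t K).toReal) (Icc (0:ℝ) T))
    {f : E → ℝ → ℝ} (hf : Continuous (fun q : E × ℝ => f q.1 q.2)) {R : ℝ}
    (hR : ∀ x t, R < ‖x‖ → f x t = 0) :
    IntegrableOn (fun t => ∫ x, f x t ∂(p t)) (Icc (0:ℝ) T) := by
  have : SecondCountableTopology E := secondCountable_of_proper
  have hcomp := isCompact_closedBall (0:E) R
  obtain ⟨c, hc⟩ := (hcomp.prod (isCompact_Icc (a := (0:ℝ)) (b := T))).exists_bound_of_continuousOn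
    hf.continuousOn
  refine Integrable.mono' ((hint _ hcomp).const_mul (max c 0))
    (aestronglyMeasurable_integral_family hp hf hR (fun t ht => (hfin t ht _ hcomp).ne)
      measurableSet_Icc) ?_
  filter_upwards [ae_restrict_mem measurableSet_Icc] with t ht
  refine abs_integral_le_of_support_ball (fun x hx => hR x t hx) (fun x => ?_) (hfin t ht _ hcomp)
  by_cases hx : ‖x‖ ≤ R
  · exact (hc (x, t) ⟨by simpa using hx, ht⟩).trans (le_max_left _ _)
  · simp [hR x t (not_le.1 hx)]

/-- Abstract form of the difference of two solutions of the Cauchy problem with common initial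
data: a functional `Δ t f` (the integral of `f` against the difference at time `t`), controlled by
an `L¹` density on every ball, that satisfies the continuity equation weakly with zero data. -/
structure IsWeakNullSolution {E : Type*} [NormedAddCommGroup E] [NormedSpace ℝ E]
    (T : ℝ) (b : E → ℝ → E) (Δ : ℝ → (E → ℝ) → ℝ) : Prop where
  bound : ∀ R : ℝ, ∃ g : ℝ → ℝ, IntegrableOn g (Icc 0 T) ∧ (∀ t, 0 ≤ g t) ∧
    ∀ t ∈ Icc (0:ℝ) T, ∀ (f : E → ℝ) (c : ℝ), (∀ x, R < ‖x‖ → f x = 0) → (∀ x, |f x| ≤ c) →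
      |Δ t f| ≤ c * g t
  integrableOn : ∀ (f : E → ℝ → ℝ) (R : ℝ), Continuous (fun q : E × ℝ => f q.1 q.2) →
    (∀ x t, R < ‖x‖ → f x t = 0) → IntegrableOn (fun t => Δ t fun x => f x t) (Icc 0 T)
  weak : ∀ (u : E × ℝ → ℝ) (R : ℝ), ContDiff ℝ 1 u → (∀ x t, R < ‖x‖ → u (x, t) = 0) →
    ∀ᵐ t ∂(volume.restrict (Icc (0:ℝ) T)),
      Δ t (fun x => u (x, t)) = ∫ s in (0:ℝ)..t, Δ s fun x => fderiv ℝ u (x, s) (b x s, 1)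

lemma fderiv_eq_zero_of_norm_gt {E F : Type*} [NormedAddCommGroup E] [NormedSpace ℝ E]
    [NormedAddCommGroup F] [NormedSpace ℝ F] {w : E → F} {R : ℝ} (h : ∀ x, R < ‖x‖ → w x = 0)
    {x : E} (hx : R < ‖x‖) : fderiv ℝ w x = 0 := by
  have : w =ᶠ[𝓝 x] fun _ => 0 := by
    filter_upwards [(isOpen_lt continuous_const continuous_norm).mem_nhds hx] with y hy using h y hy
  rw [this.fderiv_eq]
  simp

lemma fderiv_prod_eq_zero_of_norm_gt {E : Type*} [NormedAddCommGroup E] [NormedSpace ℝ E]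
    {u : E × ℝ → ℝ} {R : ℝ} (h : ∀ x t, R < ‖x‖ → u (x, t) = 0) {x : E} (t : ℝ) (hx : R < ‖x‖) :
    fderiv ℝ u (x, t) = 0 := by
  have : u =ᶠ[𝓝 (x, t)] fun _ => 0 := by
    filter_upwards [(isOpen_lt continuous_const continuous_fst.norm).mem_nhds
      (show (x, t) ∈ {q : E × ℝ | R < ‖q.1‖} from hx)] with y hy using h y.1 y.2 hy
  rw [this.fderiv_eq]
  simp

/-- The transport operator `∂_t u + ⟨b, ∇u⟩` as a total derivative in space-time. -/
lemma deriv_add_inner_gradient_eq_fderiv {E : Type*} [NormedAddCommGroup E]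
    [InnerProductSpace ℝ E] [CompleteSpace E] {u : E → ℝ → ℝ} {x v : E} {t : ℝ}
    (hu : DifferentiableAt ℝ (fun q : E × ℝ => u q.1 q.2) (x, t)) :
    deriv (u x) t + ⟪v, gradient (fun y => u y t) x⟫
      = fderiv ℝ (fun q : E × ℝ => u q.1 q.2) (x, t) (v, 1) := by
  have h1 : HasDerivAt (u x) (fderiv ℝ (fun q : E × ℝ => u q.1 q.2) (x, t) (0, 1)) t :=
    hu.hasFDerivAt.comp_hasDerivAt t ((hasDerivAt_const t x).prodMk (hasDerivAt_id t))
  have h2 : HasFDerivAt (fun y => u y t) ((fderiv ℝ (fun q : E × ℝ => u q.1 q.2) (x, t)).comp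
      (ContinuousLinearMap.inl ℝ E ℝ)) x :=
    HasFDerivAt.comp (g := fun q : E × ℝ => u q.1 q.2) (f := fun y => (y, t)) x hu.hasFDerivAt
      (hasFDerivAt_prodMk_left x t)
  rw [h1.deriv, inner_gradient_right, h2.fderiv]
  simp [← map_add]

lemma isWeakNullSolution_sint_sub {d : ℕ} {T : ℝ}
    {b : EuclideanSpace ℝ (Fin d) → ℝ → EuclideanSpace ℝ (Fin d)}
    (hb : Continuous (fun q : EuclideanSpace ℝ (Fin d) × ℝ => b q.1 q.2))
    {νp νn : Measure (EuclideanSpace ℝ (Fin d))}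
    {p₁ n₁ p₂ n₂ : ℝ → Measure (EuclideanSpace ℝ (Fin d))}
    (hfam₁ : IsLocFamily T p₁ n₁) (hfam₂ : IsLocFamily T p₂ n₂)
    (hsol₁ : IsSolution T b νp νn p₁ n₁) (hsol₂ : IsSolution T b νp νn p₂ n₂) :
    IsWeakNullSolution T b fun t f => sint p₁ n₁ t f - sint p₂ n₂ t f := by
  have hsplit : ∀ p n : ℝ → Measure (EuclideanSpace ℝ (Fin d)), IsLocFamily T p n →
      ∀ K : Set (EuclideanSpace ℝ (Fin d)), IsCompact K →
        IntegrableOn (fun t => (p t K).toReal) (Icc (0:ℝ) T) ∧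
        IntegrableOn (fun t => (n t K).toReal) (Icc (0:ℝ) T) := by
    intro p n h K hK
    obtain ⟨hp, hn⟩ := h.2.2.1 K hK.measurableSet hK.isBounded
    constructor
    · refine Integrable.mono' (h.2.2.2 K hK) hp.ennreal_toReal.aestronglyMeasurable
        (.of_forall fun t => ?_)
      simp
    · refine Integrable.mono' (h.2.2.2 K hK) hn.ennreal_toReal.aestronglyMeasurable
        (.of_forall fun t => ?_)
      simp
  have hint : ∀ p n : ℝ → Measure (EuclideanSpace ℝ (Fin d)), IsLocFamily T p n →
      ∀ (f : EuclideanSpace ℝ (Fin d) → ℝ → ℝ) (R : ℝ),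
        Continuous (fun q : EuclideanSpace ℝ (Fin d) × ℝ => f q.1 q.2) →
        (∀ x t, R < ‖x‖ → f x t = 0) →
          IntegrableOn (fun t => sint p n t fun x => f x t) (Icc 0 T) := by
    intro p n h f R hf hR
    exact (integrableOn_integral_family (fun t ht K hK => (h.1 t ht K hK).1)
        (fun B hB hB' => (h.2.2.1 B hB hB').1) (fun K hK => (hsplit p n h K hK).1) hf hR).sub
      (integrableOn_integral_family (fun t ht K hK => (h.1 t ht K hK).2)
        (fun B hB hB' => (h.2.2.1 B hB hB').2) (fun K hK => (hsplit p n h K hK).2) hf hR)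
  refine ⟨fun R => ?_, fun f R hf hR => (hint p₁ n₁ hfam₁ f R hf hR).sub
    (hint p₂ n₂ hfam₂ f R hf hR), fun u R hu hR => ?_⟩
  · have hK := isCompact_closedBall (0 : EuclideanSpace ℝ (Fin d)) R
    set B := closedBall (0 : EuclideanSpace ℝ (Fin d)) R
    refine ⟨fun t => ((p₁ t B).toReal + (n₁ t B).toReal) + ((p₂ t B).toReal + (n₂ t B).toReal),
      (hfam₁.2.2.2 B hK).add (hfam₂.2.2.2 B hK), fun t => by positivity,
      fun t ht f c hf hc => ?_⟩
    have h1 := abs_le.1 (abs_integral_le_of_support_ball hf hc (hfam₁.1 t ht B hK).1)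
    have h2 := abs_le.1 (abs_integral_le_of_support_ball hf hc (hfam₁.1 t ht B hK).2)
    have h3 := abs_le.1 (abs_integral_le_of_support_ball hf hc (hfam₂.1 t ht B hK).1)
    have h4 := abs_le.1 (abs_integral_le_of_support_ball hf hc (hfam₂.1 t ht B hK).2)
    simp only [sint]
    rw [abs_le]
    constructor <;> linarith [h1.1, h1.2, h2.1, h2.2, h3.1, h3.2, h4.1, h4.2]
  · set F : EuclideanSpace ℝ (Fin d) → ℝ → ℝ := fun x s => fderiv ℝ u (x, s) (b x s, 1) with hF
    have hFc : Continuous (fun q : EuclideanSpace ℝ (Fin d) × ℝ => F q.1 q.2) :=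
      (hu.continuous_fderiv one_ne_zero).clm_apply (hb.prodMk continuous_const)
    have hF0 : ∀ x t, R < ‖x‖ → F x t = 0 := fun x t hx => by
      simp [hF, fderiv_prod_eq_zero_of_norm_gt hR t hx]
    have hR' : ∃ R' > 0, ∀ (x : EuclideanSpace ℝ (Fin d)) (t : ℝ), R' < ‖x‖ → u (x, t) = 0 :=
      ⟨max R 1, by positivity, fun x t hx => hR x t ((le_max_left _ _).trans_lt hx)⟩
    have heq : ∀ x s, deriv (fun t => u (x, t)) s
        + ⟪b x s, gradient (fun y => u (y, s)) x⟫ = F x s := fun x s =>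
      deriv_add_inner_gradient_eq_fderiv (u := fun y t => u (y, t))
        (hu.differentiable one_ne_zero _)
    have e1 := hsol₁.2 (fun x t => u (x, t)) hu hR'
    have e2 := hsol₂.2 (fun x t => u (x, t)) hu hR'
    filter_upwards [e1, e2, ae_restrict_mem measurableSet_Icc] with t h1 h2 ht
    simp only [heq] at h1 h2
    have hsub : Icc (0:ℝ) t ⊆ Icc 0 T := Icc_subset_Icc_right ht.2
    rw [h1, h2, intervalIntegral.integral_of_le ht.1, ← integral_Icc_eq_integral_Ioc,
      integral_sub ((hint p₁ n₁ hfam₁ F R hFc hF0).mono_set hsub)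
        ((hint p₂ n₂ hfam₂ F R hFc hF0).mono_set hsub)]
    ring

/-- The indicator of an open set is a pointwise limit of smooth functions. -/
lemma exists_contDiff_tendsto_indicator {E : Type*} [NormedAddCommGroup E] [NormedSpace ℝ E]
    [FiniteDimensional ℝ E] {V : Set E} (hV : IsOpen V) :
    ∃ w : ℕ → E → ℝ, (∀ m, ContDiff ℝ 1 (w m)) ∧ (∀ m, ∀ x ∉ V, w m x = 0) ∧
      (∀ m x, |w m x| ≤ 1) ∧
      ∀ x, Tendsto (fun m => w m x) atTop (𝓝 (V.indicator (fun _ => (1:ℝ)) x)) := by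
  obtain ⟨f, hsupp, hf, hrange⟩ := hV.exists_contDiff_support_eq (n := 1)
  have h0 : ∀ x ∉ V, f x = 0 := fun x hx => by
    rw [← hsupp] at hx
    simpa using hx
  refine ⟨fun m x => Real.smoothTransition (m * f x), fun m => ?_, fun m x hx => ?_,
    fun m x => ?_, fun x => ?_⟩
  · exact (Real.smoothTransition.contDiff (n := 1)).comp (contDiff_const.mul hf)
  · simp [h0 x hx, Real.smoothTransition.zero]
  · rw [abs_of_nonneg (Real.smoothTransition.nonneg _)]
    exact Real.smoothTransition.le_one _
  · by_cases hx : x ∈ V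
    · have hpos : 0 < f x := by
        refine lt_of_le_of_ne (hrange ⟨x, rfl⟩).1 (Ne.symm ?_)
        rw [← hsupp] at hx
        exact hx
      rw [indicator_of_mem hx]
      refine tendsto_const_nhds.congr' ?_
      have : Tendsto (fun m : ℕ => (m:ℝ) * f x) atTop atTop :=
        tendsto_natCast_atTop_atTop.atTop_mul_const hpos
      filter_upwards [this.eventually_ge_atTop 1] with m hm
      exact (Real.smoothTransition.one_of_one_le hm).symm
    · rw [indicator_of_notMem hx]
      simp [h0 x hx, Real.smoothTransition.zero]

/-- A countable family of compactly supported `C¹` functions separates differences of locally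
finite measures. -/
lemma exists_countable_separating_contDiff (E : Type*) [NormedAddCommGroup E] [NormedSpace ℝ E]
    [FiniteDimensional ℝ E] [MeasurableSpace E] [BorelSpace E] :
    ∃ W : Set (E → ℝ), W.Countable ∧
      (∀ w ∈ W, ContDiff ℝ 1 w ∧ ∃ R : ℝ, ∀ x, R < ‖x‖ → w x = 0) ∧
      ∀ a a' c c' : Measure E, (∀ K, IsCompact K → a K < ⊤) → (∀ K, IsCompact K → a' K < ⊤) →
        (∀ K, IsCompact K → c K < ⊤) → (∀ K, IsCompact K → c' K < ⊤) →
        (∀ w ∈ W, (∫ x, w x ∂a) - ∫ x, w x ∂a' = (∫ x, w x ∂c) - ∫ x, w x ∂c') →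
        a + c' = c + a' := by
  have : ProperSpace E := FiniteDimensional.proper ℝ E
  have : SecondCountableTopology E := secondCountable_of_proper
  set 𝓑 := TopologicalSpace.countableBasis E with h𝓑
  have hbasis := TopologicalSpace.isBasis_countableBasis E
  have hcount : 𝓑.Countable := TopologicalSpace.countable_countableBasis E
  set 𝓕 : Set (Set (Set E)) := {F | F.Finite ∧ F ⊆ 𝓑} with h𝓕
  have h𝓕c : 𝓕.Countable := countable_ofPred_finite_subset hcount
  set V : Set (Set E) × ℕ → Set E := fun q => ball 0 q.2 ∩ ⋂₀ q.1 with hV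
  have hVopen : ∀ q ∈ 𝓕 ×ˢ (univ : Set ℕ), IsOpen (V q) := fun q hq =>
    isOpen_ball.inter (hq.1.1.isOpen_sInter fun s hs => hbasis.isOpen (hq.1.2 hs))
  have hw : ∀ q : Set (Set E) × ℕ, ∃ w : ℕ → E → ℝ, q ∈ 𝓕 ×ˢ (univ : Set ℕ) →
      (∀ m, ContDiff ℝ 1 (w m)) ∧ (∀ m, ∀ x ∉ V q, w m x = 0) ∧ (∀ m x, |w m x| ≤ 1) ∧
      ∀ x, Tendsto (fun m => w m x) atTop (𝓝 ((V q).indicator (fun _ => (1:ℝ)) x)) := by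
    intro q
    by_cases hq : q ∈ 𝓕 ×ˢ (univ : Set ℕ)
    · obtain ⟨w, hw⟩ := exists_contDiff_tendsto_indicator (hVopen q hq)
      exact ⟨w, fun _ => hw⟩
    · exact ⟨fun _ _ => 0, fun h => absurd h hq⟩
  choose w hw using hw
  refine ⟨⋃ q ∈ 𝓕 ×ˢ (univ : Set ℕ), range (w q), ?_, ?_, ?_⟩
  · exact (h𝓕c.prod countable_univ).biUnion fun q _ => countable_range _
  · simp only [mem_iUnion]
    rintro _ ⟨q, hq, m, rfl⟩
    refine ⟨(hw q hq).1 m, q.2, fun x hx => (hw q hq).2.1 m x fun hxV => ?_⟩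
    have := hxV.1
    rw [mem_ball_zero_iff] at this
    exact absurd hx this.not_gt
  · intro a a' c c' ha ha' hc hc' h
    have hfin : ∀ μ : Measure E, (∀ K, IsCompact K → μ K < ⊤) → ∀ q, μ (V q) < ⊤ := fun μ hμ q =>
      (measure_mono (inter_subset_left.trans ball_subset_closedBall)).trans_lt
        (hμ _ (isCompact_closedBall (0:E) q.2))
    have hlim : ∀ μ : Measure E, (∀ K, IsCompact K → μ K < ⊤) → ∀ q ∈ 𝓕 ×ˢ (univ : Set ℕ),
        Tendsto (fun m => ∫ x, w q m x ∂μ) atTop (𝓝 (μ (V q)).toReal) := by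
      intro μ hμ q hq
      have hVm : MeasurableSet (V q) := (hVopen q hq).measurableSet
      have hi : ∫ x, (V q).indicator (fun _ => (1:ℝ)) x ∂μ = (μ (V q)).toReal := by
        rw [integral_indicator_const _ hVm]
        simp [Measure.real]
      rw [← hi]
      refine tendsto_integral_of_dominated_convergence ((V q).indicator fun _ => (1:ℝ))
        (fun m => ((hw q hq).1 m).continuous.aestronglyMeasurable)
        ((integrable_indicator_iff hVm).2 (integrableOn_const (hfin μ hμ q).ne))
        (fun m => .of_forall fun x => ?_) (.of_forall (hw q hq).2.2.2)
      by_cases hx : x ∈ V q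
      · rw [indicator_of_mem hx]
        exact (hw q hq).2.2.1 m x
      · simp [indicator_of_notMem hx, (hw q hq).2.1 m x hx]
    refine Measure.ext_of_generateFrom_of_iUnion (V '' (𝓕 ×ˢ univ))
      (fun N : ℕ => V (∅, N)) ?_ ?_ ?_ ?_ ?_ ?_
    · refine le_antisymm ?_ ?_
      · refine ((BorelSpace.measurable_eq (α := E)).trans hbasis.borel_eq_generateFrom).le.trans ?_
        refine MeasurableSpace.generateFrom_le fun U hU => ?_
        have : U = ⋃ N : ℕ, V ({U}, N) := by
          simp only [hV, sInter_singleton, ← iUnion_inter, iUnion_ball_nat, univ_inter]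
        rw [this]
        refine MeasurableSet.iUnion fun N => MeasurableSpace.measurableSet_generateFrom ?_
        exact ⟨({U}, N), ⟨⟨finite_singleton U, by simpa using hU⟩, mem_univ _⟩, rfl⟩
      · refine MeasurableSpace.generateFrom_le ?_
        rintro _ ⟨q, hq, rfl⟩
        exact (hVopen q hq).measurableSet
    · rintro _ ⟨q, hq, rfl⟩ _ ⟨q', hq', rfl⟩ -
      refine ⟨(q.1 ∪ q'.1, min q.2 q'.2), ⟨⟨hq.1.1.union hq'.1.1, union_subset hq.1.2 hq'.1.2⟩,
        mem_univ _⟩, ?_⟩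
      ext x
      simp only [hV, sInter_union, mem_inter_iff, mem_ball_zero_iff, Nat.cast_min, lt_min_iff]
      tauto
    · simp [hV, iUnion_ball_nat]
    · exact fun N => ⟨(∅, N), ⟨⟨finite_empty, empty_subset _⟩, mem_univ _⟩, rfl⟩
    · intro N
      rw [Measure.add_apply]
      exact (ENNReal.add_lt_top.2 ⟨hfin a ha _, hfin c' hc' _⟩).ne
    · rintro _ ⟨q, hq, rfl⟩
      have heq : (a (V q)).toReal - (a' (V q)).toReal = (c (V q)).toReal - (c' (V q)).toReal := by
        refine tendsto_nhds_unique ((hlim a ha q hq).sub (hlim a' ha' q hq)) ?_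
        refine ((hlim c hc q hq).sub (hlim c' hc' q hq)).congr fun m => ?_
        exact (h _ (mem_biUnion hq (mem_range_self m))).symm
      rw [Measure.add_apply, Measure.add_apply, ← ENNReal.toReal_eq_toReal_iff'
        (ENNReal.add_lt_top.2 ⟨hfin a ha _, hfin c' hc' _⟩).ne
        (ENNReal.add_lt_top.2 ⟨hfin c hc _, hfin a' ha' _⟩).ne,
        ENNReal.toReal_add (hfin a ha _).ne (hfin c' hc' _).ne,
        ENNReal.toReal_add (hfin c hc _).ne (hfin a' ha' _).ne]
      linarith

/-- Continuous cutoffs of an interval whose defect is small with respect to an `L¹` density. -/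
lemma exists_continuous_cutoff {a c : ℝ} {g : ℝ → ℝ}
    (hg : IntervalIntegrable g volume a c) (hac : a < c) {η : ℝ} (hη : 0 < η) :
    ∃ χ : ℝ → ℝ, Continuous χ ∧ (∀ t, 0 ≤ χ t) ∧ (∀ t, χ t ≤ 1) ∧ (∀ t ≤ a, χ t = 0) ∧
      (∀ t, c ≤ t → χ t = 0) ∧ ∫ t in a..c, (1 - χ t) * g t ≤ η := by
  set X : ℕ → ℝ → ℝ := fun m t => max 0 (min 1 (m * min (t - a) (c - t))) with hX
  have hXc : ∀ m, Continuous (X m) := fun m => by fun_prop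
  have hX0 : ∀ m t, 0 ≤ X m t := fun m t => le_max_left _ _
  have hX1 : ∀ m t, X m t ≤ 1 := fun m t => max_le zero_le_one (min_le_left _ _)
  have hXz : ∀ m t, min (t - a) (c - t) ≤ 0 → X m t = 0 := fun m t h =>
    max_eq_left ((min_le_right _ _).trans (mul_nonpos_of_nonneg_of_nonpos (Nat.cast_nonneg m) h))
  have hlim : Tendsto (fun m => ∫ t in a..c, (1 - X m t) * g t) atTop (𝓝 (∫ _ in a..c, (0:ℝ))) := by
    simp only [intervalIntegral.integral_of_le hac.le, integral_Ioc_eq_integral_Ioo]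
    have hgi : IntegrableOn g (Ioo a c) :=
      ((intervalIntegrable_iff_integrableOn_Ioc_of_le hac.le).1 hg).mono_set Ioo_subset_Ioc_self
    refine tendsto_integral_of_dominated_convergence (fun t => ‖g t‖)
      (fun m => ((continuous_const.sub (hXc m)).aestronglyMeasurable).mul hgi.aestronglyMeasurable)
      hgi.norm (fun m => .of_forall fun t => ?_) ?_
    · rw [norm_mul, Real.norm_of_nonneg (sub_nonneg.2 (hX1 m t))]
      exact mul_le_of_le_one_left (norm_nonneg _) (by linarith [hX0 m t])
    · filter_upwards [ae_restrict_mem measurableSet_Ioo] with t ht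
      refine tendsto_const_nhds.congr' ?_
      have hpos : 0 < min (t - a) (c - t) := lt_min (sub_pos.2 ht.1) (sub_pos.2 ht.2)
      have : Tendsto (fun m : ℕ => (m:ℝ) * min (t - a) (c - t)) atTop atTop :=
        tendsto_natCast_atTop_atTop.atTop_mul_const hpos
      filter_upwards [this.eventually_ge_atTop 1] with m hm
      simp [hX, min_eq_left hm]
  rw [intervalIntegral.integral_zero] at hlim
  obtain ⟨m, hm⟩ := (hlim.eventually_le_const hη).exists
  exact ⟨X m, hXc m, hX0 m, hX1 m, fun t ht => hXz m t (min_le_of_left_le (by linarith)),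
    fun t ht => hXz m t (min_le_of_right_le (by linarith)), hm⟩

/-- A `C¹` clock that runs down from (almost) `c - a` to `0` on `[a, c]` with (almost) unit speed
and stands still elsewhere. -/
lemma exists_contDiff_clock {a c : ℝ} {g : ℝ → ℝ}
    (hg : IntervalIntegrable g volume a c) (hac : a < c) {η : ℝ} (hη : 0 < η) :
    ∃ χ l : ℝ → ℝ, Continuous χ ∧ ContDiff ℝ 1 l ∧ (∀ t, HasDerivAt l (-χ t) t) ∧
      (∀ t, 0 ≤ χ t) ∧ (∀ t, χ t ≤ 1) ∧ (∀ t ≤ a, χ t = 0) ∧ (∀ t, c ≤ t → χ t = 0) ∧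
      (∀ t ≤ a, l t = l a) ∧ (∀ t, c ≤ t → l t = 0) ∧ (∀ t, 0 ≤ l t ∧ l t ≤ c - a) ∧
      ∫ t in a..c, (1 - χ t) * g t ≤ η := by
  obtain ⟨χ, hχ, h0, h1, ha, hc, hint⟩ := exists_continuous_cutoff hg hac hη
  set l : ℝ → ℝ := fun t => ∫ s in t..c, χ s with hl
  have hii : ∀ s t, IntervalIntegrable χ volume s t := fun s t => hχ.intervalIntegrable s t
  have hder : ∀ t, HasDerivAt l (-χ t) t := fun t =>
    intervalIntegral.integral_hasDerivAt_left (hii t c)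
      (hχ.stronglyMeasurableAtFilter _ _) hχ.continuousAt
  have hla : ∀ t ≤ a, l t = l a := by
    intro t ht
    have : ∫ s in t..a, χ s = 0 := by
      rw [intervalIntegral.integral_congr (g := fun _ => 0) fun s hs => ?_]
      · simp
      · rw [uIcc_of_le ht] at hs
        exact ha s hs.2
    simp only [hl]
    rw [← intervalIntegral.integral_add_adjacent_intervals (hii t a) (hii a c), this, zero_add]
  have hlc : ∀ t, c ≤ t → l t = 0 := by
    intro t ht
    simp only [hl]
    rw [intervalIntegral.integral_congr (g := fun _ => 0) fun s hs => ?_]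
    · simp
    · rw [uIcc_of_ge ht] at hs
      exact hc s hs.1
  have hmid : ∀ t, a ≤ t → t ≤ c → 0 ≤ l t ∧ l t ≤ c - a := by
    intro t hat htc
    refine ⟨intervalIntegral.integral_nonneg htc fun s _ => h0 s, ?_⟩
    calc l t ≤ ∫ _ in t..c, (1:ℝ) :=
          intervalIntegral.integral_mono_on htc (hii t c) (by simp) fun s _ => h1 s
      _ ≤ c - a := by
          simp
          linarith
  refine ⟨χ, l, hχ, ?_, hder, h0, h1, ha, hc, hla, hlc, fun t => ?_, hint⟩
  · rw [contDiff_one_iff_deriv]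
    refine ⟨fun t => (hder t).differentiableAt, ?_⟩
    rw [show deriv l = fun t => -χ t from funext fun t => (hder t).deriv]
    exact hχ.neg
  · rcases le_total t a with hta | hta
    · rw [hla t hta]
      exact hmid a le_rfl hac.le
    · rcases le_total t c with htc | htc
      · exact hmid t hta htc
      · rw [hlc t htc]
        exact ⟨le_rfl, by linarith⟩

lemma exists_mem_Ioo_of_ae_restrict_Icc {T c : ℝ} (h0 : 0 ≤ c) (hc : c < T) {P : ℝ → Prop}
    (h : ∀ᵐ t ∂(volume.restrict (Icc (0:ℝ) T)), P t) : ∃ t ∈ Ioo c T, P t := by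
  have h' : ∀ᵐ t ∂(volume.restrict (Ioo c T)), P t :=
    ae_restrict_of_ae_restrict_of_subset
      (Ioo_subset_Icc_self.trans (Icc_subset_Icc_left h0)) h
  have : (ae (volume.restrict (Ioo c T))).NeBot := by
    rw [ae_neBot, Ne, Measure.restrict_eq_zero, Real.volume_Ioo]
    simp [hc]
  obtain ⟨t, ht, hP⟩ := ((ae_restrict_mem measurableSet_Ioo).and h').exists
  exact ⟨t, ht, hP⟩

section Transport

variable {E : Type*} [NormedAddCommGroup E] [NormedSpace ℝ E]

lemma fderiv_comp_fst_apply {w : E → ℝ} (hw : ContDiff ℝ 1 w) (x v : E) (s r : ℝ) :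
    fderiv ℝ (fun q : E × ℝ => w q.1) (x, s) (v, r) = fderiv ℝ w x v := by
  have h := (HasFDerivAt.comp (g := w) (f := Prod.fst) (x, s)
    (hw.differentiable one_ne_zero x).hasFDerivAt
    (hasFDerivAt_fst (𝕜 := ℝ) (E := E) (F := ℝ))).fderiv
  simp only [Function.comp_def] at h
  rw [h]
  simp

lemma fderiv_comp_moving_shift {w : E → ℝ} (hw : ContDiff ℝ 1 w) {β : E → E}
    (hβ : ContDiff ℝ 1 β) {l χ : ℝ → ℝ} (hl : ∀ t, HasDerivAt l (-χ t) t) (x v : E) (s : ℝ) :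
    fderiv ℝ (fun q : E × ℝ => w (q.1 + l q.2 • β q.1)) (x, s) (v, 1)
      = fderiv ℝ w (x + l s • β x) (v + l s • fderiv ℝ β x v - χ s • β x) := by
  have h1 : HasFDerivAt (fun q : E × ℝ => β q.1)
      ((fderiv ℝ β x).comp (ContinuousLinearMap.fst ℝ E ℝ)) (x, s) :=
    HasFDerivAt.comp (g := β) (f := Prod.fst) (x, s)
      (hβ.differentiable one_ne_zero x).hasFDerivAt hasFDerivAt_fst
  have h2 : HasFDerivAt (fun q : E × ℝ => l q.2)
      ((ContinuousLinearMap.toSpanSingleton ℝ (-χ s)).comp (ContinuousLinearMap.snd ℝ E ℝ)) (x, s) :=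
    HasFDerivAt.comp (g := l) (f := Prod.snd) (x, s) (hl s).hasFDerivAt hasFDerivAt_snd
  have h3 := HasFDerivAt.comp (g := w) (f := fun q : E × ℝ => q.1 + l q.2 • β q.1) (x, s)
    (hw.differentiable one_ne_zero _).hasFDerivAt (hasFDerivAt_fst.add (h2.smul h1))
  have h4 := h3.fderiv
  simp only [Function.comp_def] at h4
  rw [h4]
  simp [sub_eq_add_neg, add_assoc]

lemma fderiv_comp_shift {w : E → ℝ} (hw : ContDiff ℝ 1 w) {β : E → E}
    (hβ : ContDiff ℝ 1 β) (h : ℝ) (x v : E) :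
    fderiv ℝ (fun y => w (y + h • β y)) x v
      = fderiv ℝ w (x + h • β x) (v + h • fderiv ℝ β x v) := by
  have h1 : HasFDerivAt (fun y => y + h • β y) (ContinuousLinearMap.id ℝ E + h • fderiv ℝ β x) x :=
    (hasFDerivAt_id x).add ((hβ.differentiable one_ne_zero x).hasFDerivAt.const_smul h)
  have h3 := HasFDerivAt.comp (g := w) x (hw.differentiable one_ne_zero _).hasFDerivAt h1
  have h4 := h3.fderiv
  simp only [Function.comp_def] at h4
  rw [h4]
  simp

/-- One backward Euler step: moving the test function along an autonomous field `β` close to `b`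
changes the accumulated transport functional only by a small error. -/
lemma IsWeakNullSolution.exists_euler_step {T : ℝ} {b : E → ℝ → E} {Δ : ℝ → (E → ℝ) → ℝ}
    (hΔ : IsWeakNullSolution T b Δ) (hb : Continuous (fun q : E × ℝ => b q.1 q.2))
    {a c : ℝ} (ha : 0 ≤ a) (hac : a < c) (hcT : c < T) {β : E → E} (hβ : ContDiff ℝ 1 β)
    {w : E → ℝ} (hw : ContDiff ℝ 1 w) {R M B ε₁ ε₂ : ℝ}
    (hsupp : ∀ h, 0 ≤ h → h ≤ c - a → ∀ x, R < ‖x‖ → w (x + h • β x) = 0)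
    (hM : ∀ x, ‖fderiv ℝ w x‖ ≤ M) (hB : 0 ≤ B) (hε₁ : 0 ≤ ε₁) (hε₂ : 0 ≤ ε₂)
    (hβB : ∀ x, ‖x‖ ≤ R → ‖β x‖ ≤ B)
    (hbβ : ∀ x, ‖x‖ ≤ R → ∀ s ∈ Icc a c, ‖b x s - β x‖ ≤ ε₁)
    (hDβ : ∀ x, ‖x‖ ≤ R → ∀ s ∈ Icc a c, (c - a) * ‖fderiv ℝ β x (b x s)‖ ≤ ε₂)
    {g : ℝ → ℝ} (hg : IntegrableOn g (Icc 0 T))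
    (hgΔ : ∀ t ∈ Icc (0:ℝ) T, ∀ (f : E → ℝ) (k : ℝ), (∀ x, R < ‖x‖ → f x = 0) →
      (∀ x, |f x| ≤ k) → |Δ t f| ≤ k * g t) {η : ℝ} (hη : 0 < η) :
    ∃ h, 0 ≤ h ∧ h ≤ c - a ∧
      |(∫ s in (0:ℝ)..c, Δ s fun x => fderiv ℝ w x (b x s))
        - ∫ s in (0:ℝ)..a, Δ s fun x => fderiv ℝ (fun y => w (y + h • β y)) x (b x s)|
      ≤ M * (ε₁ + ε₂) * (∫ s in a..c, g s) + η := by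
  have hM0 : 0 ≤ M := (norm_nonneg _).trans (hM 0)
  have hii : ∀ {f : ℝ → ℝ}, IntegrableOn f (Icc 0 T) → ∀ {s t : ℝ}, 0 ≤ s → s ≤ t → t ≤ T →
      IntervalIntegrable f volume s t := fun hf _ _ hs hst ht =>
    (intervalIntegrable_iff_integrableOn_Icc_of_le hst).2 (hf.mono_set (Icc_subset_Icc hs ht))
  have hη' : 0 < η / (M * B + 1) := by positivity
  obtain ⟨χ, l, hχ, hl, hder, h0, h1, hχa, hχc, hla, hlc, hlb, hint⟩ :=
    exists_contDiff_clock (hii hg ha hac.le hcT.le) hac hη'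
  refine ⟨l a, (hlb a).1, (hlb a).2, ?_⟩
  set u : E × ℝ → ℝ := fun q => w (q.1 + l q.2 • β q.1) with hu
  have huc : ContDiff ℝ 1 u :=
    hw.comp (contDiff_fst.add ((hl.comp contDiff_snd).smul (hβ.comp contDiff_fst)))
  have husupp : ∀ x t, R < ‖x‖ → u (x, t) = 0 := fun x t hx =>
    hsupp _ (hlb t).1 (hlb t).2 x hx
  have hwsupp : ∀ x, R < ‖x‖ → w x = 0 := fun x hx => by
    simpa using hsupp 0 le_rfl (by linarith) x hx
  set F : E → ℝ → ℝ := fun x s => fderiv ℝ u (x, s) (b x s, 1) with hF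
  set G : E → ℝ → ℝ := fun x s => fderiv ℝ w x (b x s) with hG
  have hFc : Continuous (fun q : E × ℝ => F q.1 q.2) :=
    (huc.continuous_fderiv one_ne_zero).clm_apply (hb.prodMk continuous_const)
  have hGc : Continuous (fun q : E × ℝ => G q.1 q.2) :=
    ((hw.continuous_fderiv one_ne_zero).comp continuous_fst).clm_apply hb
  have hF0 : ∀ x t, R < ‖x‖ → F x t = 0 := fun x t hx => by
    simp [hF, fderiv_prod_eq_zero_of_norm_gt husupp t hx]
  have hG0 : ∀ x t, R < ‖x‖ → G x t = 0 := fun x t hx => by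
    simp [hG, fderiv_eq_zero_of_norm_gt hwsupp hx]
  have hFi := hΔ.integrableOn F R hFc hF0
  have hGi := hΔ.integrableOn G R hGc hG0
  have hFv : ∀ x s, F x s = fderiv ℝ w (x + l s • β x)
      (b x s + l s • fderiv ℝ β x (b x s) - χ s • β x) := fun x s =>
    fderiv_comp_moving_shift hw hβ hder x (b x s) s
  have hFG : ∀ x s, c ≤ s → F x s = G x s := fun x s hs => by
    rw [hFv, hlc s hs, hχc s hs]
    simp [hG]
  have hFa : ∀ x s, s ≤ a → F x s = fderiv ℝ (fun y => w (y + l a • β y)) x (b x s) :=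
    fun x s hs => by
      rw [hFv, hla s hs, hχa s hs, fderiv_comp_shift hw hβ]
      simp
  have hweakG := hΔ.weak (fun q => w q.1) R (hw.comp contDiff_fst) fun x t hx => hwsupp x hx
  simp only [fderiv_comp_fst_apply hw] at hweakG
  obtain ⟨t, ht, hFt, hGt⟩ := exists_mem_Ioo_of_ae_restrict_Icc (ha.trans hac.le) hcT
    ((hΔ.weak u R huc husupp).and hweakG)
  have hut : (fun x => u (x, t)) = w := by
    ext x
    simp [hu, hlc t ht.1.le]
  rw [hut, hGt] at hFt
  have hc0 : 0 ≤ c := ha.trans hac.le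
  rw [← intervalIntegral.integral_add_adjacent_intervals (hii hGi le_rfl hc0 hcT.le)
      (hii hGi hc0 ht.1.le ht.2.le),
    ← intervalIntegral.integral_add_adjacent_intervals (hii hFi le_rfl hc0 hcT.le)
      (hii hFi hc0 ht.1.le ht.2.le),
    ← intervalIntegral.integral_add_adjacent_intervals (hii hFi le_rfl ha (hac.le.trans hcT.le))
      (hii hFi ha hac.le hcT.le)] at hFt
  have e1 : ∫ s in c..t, Δ s (fun x => F x s) = ∫ s in c..t, Δ s fun x => G x s := by
    refine intervalIntegral.integral_congr fun s hs => ?_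
    rw [uIcc_of_le ht.1.le] at hs
    simp only [hFG _ s hs.1]
  have e2 : ∫ s in (0:ℝ)..a, Δ s (fun x => F x s)
      = ∫ s in (0:ℝ)..a, Δ s fun x => fderiv ℝ (fun y => w (y + l a • β y)) x (b x s) := by
    refine intervalIntegral.integral_congr fun s hs => ?_
    rw [uIcc_of_le ha] at hs
    simp only [hFa _ s hs.2]
  rw [e2] at hFt
  have e3 : (∫ s in (0:ℝ)..c, Δ s fun x => fderiv ℝ w x (b x s))
      - ∫ s in (0:ℝ)..a, Δ s (fun x => fderiv ℝ (fun y => w (y + l a • β y)) x (b x s))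
      = ∫ s in a..c, Δ s fun x => F x s := by
    change (∫ s in (0:ℝ)..c, Δ s fun x => G x s) - _ = _
    change (∫ s in (0:ℝ)..c, Δ s fun x => G x s) + (∫ s in c..t, Δ s fun x => G x s)
      = _ + (∫ s in a..c, Δ s fun x => F x s) + (∫ s in c..t, Δ s fun x => F x s) at hFt
    linarith
  rw [e3]
  have hgi := hii hg ha hac.le hcT.le
  have hχg : IntervalIntegrable (fun s => (1 - χ s) * g s) volume a c :=
    hgi.continuousOn_mul (continuous_const.sub hχ).continuousOn
  have hbound : ∀ s ∈ Ioc a c, ‖Δ s fun x => F x s‖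
      ≤ M * (ε₁ + ε₂) * g s + M * B * ((1 - χ s) * g s) := by
    intro s hs
    have hs' : s ∈ Icc a c := Ioc_subset_Icc_self hs
    have h1χ : 0 ≤ 1 - χ s := sub_nonneg.2 (h1 s)
    have := hgΔ s ⟨ha.trans hs'.1, hs'.2.trans hcT.le⟩ (fun x => F x s)
      (M * (ε₁ + ε₂ + (1 - χ s) * B)) (fun x hx => hF0 x s hx) fun x => ?_
    · calc ‖Δ s fun x => F x s‖ ≤ M * (ε₁ + ε₂ + (1 - χ s) * B) * g s := this
        _ = _ := by ring
    · by_cases hx : ‖x‖ ≤ R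
      · rw [hFv, ← Real.norm_eq_abs]
        refine (ContinuousLinearMap.le_opNorm _ _).trans ?_
        refine mul_le_mul (hM _) ?_ (norm_nonneg _) hM0
        have hdec : b x s + l s • fderiv ℝ β x (b x s) - χ s • β x
            = (b x s - β x) + l s • fderiv ℝ β x (b x s) + (1 - χ s) • β x := by
          module
        rw [hdec]
        refine (norm_add₃_le).trans ?_
        refine add_le_add_three (hbβ x hx s hs') ?_ ?_
        · rw [norm_smul, Real.norm_of_nonneg (hlb s).1]
          exact (mul_le_mul_of_nonneg_right (hlb s).2 (norm_nonneg _)).trans (hDβ x hx s hs')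
        · rw [norm_smul, Real.norm_of_nonneg h1χ]
          exact mul_le_mul_of_nonneg_left (hβB x hx) h1χ
      · rw [hF0 x s (not_le.1 hx), abs_zero]
        positivity
  have hfin := intervalIntegral.norm_integral_le_of_norm_le hac.le (.of_forall hbound)
    ((hgi.const_mul _).add (hχg.const_mul _))
  rw [Real.norm_eq_abs, intervalIntegral.integral_add (hgi.const_mul _) (hχg.const_mul _),
    intervalIntegral.integral_const_mul, intervalIntegral.integral_const_mul] at hfin
  refine hfin.trans (add_le_add le_rfl ?_)
  calc M * B * ∫ s in a..c, (1 - χ s) * g s ≤ M * B * (η / (M * B + 1)) := by gcongr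
    _ ≤ η := by
      rw [mul_div_assoc', div_le_iff₀ (by positivity)]
      nlinarith [mul_nonneg hM0 hB]

end Transport

/-- Mollification in space: a continuous field of linear growth satisfying a one-sided Lipschitz
condition is approximated, uniformly on a ball and in time, by smooth fields that satisfy the same
one-sided Lipschitz condition and are uniformly Lipschitz on the ball. -/
lemma exists_smooth_oneSidedLipschitz_approx {E : Type*} [NormedAddCommGroup E]
    [InnerProductSpace ℝ E] [FiniteDimensional ℝ E] {b : E → ℝ → E}
    (hb : Continuous (fun q : E × ℝ => b q.1 q.2)) {T C C₃ : ℝ} (hC : 0 ≤ C)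
    (hgrowth : ∀ x, ∀ t ∈ Icc (0:ℝ) T, ‖b x t‖ ≤ C * (1 + ‖x‖))
    (hosl : ∀ x y, ∀ t ∈ Icc (0:ℝ) T, ⟪b x t - b y t, x - y⟫ ≤ C₃ * ‖x - y‖ ^ 2)
    {R ε : ℝ} (hR : 0 ≤ R) (hε : 0 < ε) :
    ∃ (β : ℝ → E → E) (L : ℝ), 0 ≤ L ∧ ∀ t ∈ Icc (0:ℝ) T, ContDiff ℝ 1 (β t) ∧
      (∀ x, ‖β t x‖ ≤ 4 * C * (1 + ‖x‖)) ∧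
      (∀ x y, ⟪β t x - β t y, x - y⟫ ≤ C₃ * ‖x - y‖ ^ 2) ∧
      (∀ x, ‖x‖ ≤ R → ‖b x t - β t x‖ ≤ ε) ∧
      ∀ x ∈ ball (0:E) (R + 1), ∀ y ∈ ball (0:E) (R + 1), ‖β t x - β t y‖ ≤ L * ‖x - y‖ := by
  borelize E
  set μ : Measure E := Measure.addHaar
  have hbt : ∀ t, Continuous fun x => b x t := fun t =>
    hb.comp (continuous_id.prodMk continuous_const)
  have hK : IsCompact (closedBall (0:E) (R + 1) ×ˢ Icc (0:ℝ) T) :=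
    (isCompact_closedBall _ _).prod isCompact_Icc
  obtain ⟨δ, hδ, hδb⟩ := Metric.uniformContinuousOn_iff_le.1
    (hK.uniformContinuousOn_of_continuous hb.continuousOn) ε hε
  set r : ℝ := min δ 1 with hr
  have hr0 : 0 < r := lt_min hδ one_pos
  let φ : ContDiffBump (0:E) := ⟨r / 2, r, half_pos hr0, half_lt_self hr0⟩
  have hφr : φ.rOut = r := rfl
  set ρ : E → ℝ := φ.normed μ with hρ
  have hρs : HasCompactSupport ρ := φ.hasCompactSupport_normed
  have hρc : ContDiff ℝ 1 ρ := φ.contDiff_normed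
  have hρ0 : ∀ s, 0 ≤ ρ s := φ.nonneg_normed
  have hρsupp : ∀ s, 1 ≤ ‖s‖ → ρ s = 0 := fun s hs => by
    have : s ∉ Function.support ρ := by
      rw [hρ, φ.support_normed_eq, hφr, mem_ball_zero_iff, not_lt]
      exact (min_le_right _ _).trans hs
    simpa using this
  obtain ⟨K, hKρ⟩ := hρc.lipschitzWith_of_hasCompactSupport hρs one_ne_zero
  set β : ℝ → E → E := fun t =>
    convolution ρ (fun x => b x t) (ContinuousLinearMap.lsmul ℝ ℝ) μ with hβ
  have hex : ∀ t, ConvolutionExists ρ (fun x => b x t) (ContinuousLinearMap.lsmul ℝ ℝ) μ :=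
    fun t => hρs.convolutionExists_left _ hρc.continuous (hbt t).locallyIntegrable
  set V : ℝ := (μ (closedBall (0:E) (R + 2))).toReal
  have hβdist : ∀ t x k, (∀ y ∈ ball x r, dist (b y t) (b x t) ≤ k) →
      ‖β t x - b x t‖ ≤ k := fun t x k h => by
    rw [← dist_eq_norm]
    exact φ.dist_normed_convolution_le (hbt t).aestronglyMeasurable h
  refine ⟨β, K * (C * (R + 3)) * V, by positivity, fun t ht => ⟨?_, ?_, ?_, ?_, ?_⟩⟩
  · exact hρs.contDiff_convolution_left _ hρc (hbt t).locallyIntegrable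
  · intro x
    have h1 : ‖β t x - b x t‖ ≤ 3 * C * (1 + ‖x‖) := by
      refine hβdist t x _ fun y hy => ?_
      have hyx : ‖y‖ ≤ ‖x‖ + 1 := by
        have h2 : ‖y - x‖ ≤ 1 := by
          rw [← dist_eq_norm]
          exact (mem_ball.1 hy).le.trans (min_le_right _ _)
        have h3 := norm_sub_norm_le y x
        linarith
      rw [dist_eq_norm]
      refine (norm_sub_le _ _).trans ((add_le_add (hgrowth y t ht) (hgrowth x t ht)).trans ?_)
      nlinarith [norm_nonneg x, mul_nonneg hC (norm_nonneg x)]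
    have h2 := norm_add_le (β t x - b x t) (b x t)
    rw [sub_add_cancel] at h2
    linarith [hgrowth x t ht]
  · intro x y
    have hint : ∀ z, Integrable (fun s => ρ s • b (z - s) t) μ := fun z => hex t z
    have h1 : β t x - β t y = ∫ s, (ρ s • b (x - s) t - ρ s • b (y - s) t) ∂μ :=
      (integral_sub (hint x) (hint y)).symm
    have hdiff : Integrable (fun s => ρ s • b (x - s) t - ρ s • b (y - s) t) μ :=
      (hint x).sub (hint y)
    rw [h1, real_inner_comm, ← integral_inner hdiff]
    have hρ1 : ∫ s, ρ s * (C₃ * ‖x - y‖ ^ 2) ∂μ = C₃ * ‖x - y‖ ^ 2 := by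
      rw [integral_mul_const, φ.integral_normed, one_mul]
    rw [← hρ1]
    refine integral_mono (hdiff.const_inner _) (φ.integrable_normed.mul_const _)
      fun s => ?_
    have h2 := hosl (x - s) (y - s) t ht
    rw [sub_sub_sub_cancel_right] at h2
    change ⟪x - y, ρ s • b (x - s) t - ρ s • b (y - s) t⟫ ≤ ρ s * (C₃ * ‖x - y‖ ^ 2)
    rw [← smul_sub, inner_smul_right, real_inner_comm]
    exact mul_le_mul_of_nonneg_left h2 (hρ0 s)
  · intro x hx
    rw [norm_sub_rev]
    refine hβdist t x ε fun y hy => ?_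
    have hyx : dist y x < r := hy
    have h1 : ‖y‖ ≤ R + 1 := by
      have h2 := norm_sub_norm_le y x
      rw [← dist_eq_norm] at h2
      linarith [min_le_right δ 1]
    refine hδb (y, t) ⟨by simpa using h1, ht⟩ (x, t) ⟨by simp; linarith, ht⟩ ?_
    rw [Prod.dist_eq]
    simpa [hδ.le] using hyx.le.trans (min_le_left _ _)
  · intro x hx y hy
    have hswap : ∀ z, β t z = ∫ s, ρ (z - s) • b s t ∂μ := fun z => convolution_eq_swap _
    have hint : ∀ z, Integrable (fun s => ρ (z - s) • b s t) μ := fun z =>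
      Continuous.integrable_of_hasCompactSupport
        ((hρc.continuous.comp (continuous_const.sub continuous_id)).smul (hbt t))
        ((hρs.comp_homeomorph (Homeomorph.subLeft z)).smul_right)
    have hzero : ∀ z ∈ ball (0:E) (R + 1), ∀ s ∉ closedBall (0:E) (R + 2), ρ (z - s) = 0 := by
      intro z hz s hs
      refine hρsupp _ ?_
      rw [mem_ball_zero_iff] at hz
      rw [mem_closedBall_zero_iff, not_le] at hs
      have := norm_sub_norm_le s z
      rw [norm_sub_rev] at this
      linarith
    rw [hswap, hswap, ← integral_sub (hint x) (hint y),
      ← setIntegral_eq_integral_of_forall_compl_eq_zero (s := closedBall 0 (R + 2))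
        fun s hs => by simp [hzero x hx s hs, hzero y hy s hs]]
    refine (norm_setIntegral_le_of_norm_le_const (C := K * ‖x - y‖ * (C * (R + 3)))
      measure_closedBall_lt_top fun s hs => ?_).trans_eq (by simp only [Measure.real]; ring)
    rw [← sub_smul, norm_smul]
    have h1 : ‖ρ (x - s) - ρ (y - s)‖ ≤ K * ‖x - y‖ := by
      simpa [dist_eq_norm] using hKρ.dist_le_mul (x - s) (y - s)
    have h2 : ‖b s t‖ ≤ C * (R + 3) := by
      refine (hgrowth s t ht).trans (mul_le_mul_of_nonneg_left ?_ hC)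
      have := mem_closedBall_zero_iff.1 hs
      linarith
    gcongr

lemma one_add_norm_le_exp_mul_shift {E : Type*} [NormedAddCommGroup E] [NormedSpace ℝ E]
    {C h : ℝ} (hC : 0 ≤ C) (hh : 0 ≤ h) (hhC : h * C ≤ 1 / 2) {x v : E}
    (hv : ‖v‖ ≤ C * (1 + ‖x‖)) :
    1 + ‖x‖ ≤ Real.exp (2 * C * h) * (1 + ‖x + h • v‖) := by
  have h1 : ‖x‖ ≤ ‖x + h • v‖ + ‖h • v‖ := norm_le_add_norm_add x (h • v)
  rw [norm_smul, Real.norm_of_nonneg hh] at h1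
  have h2 : h * ‖v‖ ≤ h * (C * (1 + ‖x‖)) := mul_le_mul_of_nonneg_left hv hh
  have h3 : (1 - h * C) * (1 + ‖x‖) ≤ 1 + ‖x + h • v‖ := by linarith
  have h4 : 2 * C * h + 1 ≤ Real.exp (2 * C * h) := Real.add_one_le_exp _
  have h5 : 0 ≤ h * C := mul_nonneg hh hC
  calc 1 + ‖x‖ ≤ (2 * C * h + 1) * ((1 - h * C) * (1 + ‖x‖)) := by
        have h6 : 1 ≤ (2 * C * h + 1) * (1 - h * C) := by nlinarith
        rw [← mul_assoc]
        exact le_mul_of_one_le_left (by positivity) h6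
    _ ≤ (2 * C * h + 1) * (1 + ‖x + h • v‖) := by gcongr
    _ ≤ _ := by gcongr

lemma norm_shift_sub_shift_le {E : Type*} [NormedAddCommGroup E] [InnerProductSpace ℝ E]
    {C₃ L h : ℝ} (hh : 0 ≤ h) (hhL : h * L ^ 2 ≤ 1) {x y v v' : E}
    (hosl : ⟪v - v', x - y⟫ ≤ C₃ * ‖x - y‖ ^ 2) (hlip : ‖v - v'‖ ≤ L * ‖x - y‖) :
    ‖(x + h • v) - (y + h • v')‖ ≤ Real.exp ((|C₃| + 1) * h) * ‖x - y‖ := by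
  refine (sq_le_sq₀ (norm_nonneg _) (by positivity)).1 ?_
  have h1 : (x + h • v) - (y + h • v') = (x - y) + h • (v - v') := by module
  have h2 : ‖v - v'‖ ^ 2 ≤ (L * ‖x - y‖) ^ 2 := by gcongr
  have h3 : 2 * (|C₃| + 1) * h + 1 ≤ Real.exp ((|C₃| + 1) * h) ^ 2 := by
    rw [← Real.exp_nat_mul]
    refine (Real.add_one_le_exp _).trans_eq ?_
    push_cast
    ring_nf
  rw [h1, norm_add_sq_real, inner_smul_right, real_inner_comm, norm_smul, Real.norm_of_nonneg hh,
    mul_pow, mul_pow]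
  have h4 : C₃ * ‖x - y‖ ^ 2 ≤ |C₃| * ‖x - y‖ ^ 2 :=
    mul_le_mul_of_nonneg_right (le_abs_self _) (sq_nonneg _)
  calc ‖x - y‖ ^ 2 + 2 * (h * ⟪v - v', x - y⟫) + h ^ 2 * ‖v - v'‖ ^ 2
      ≤ ‖x - y‖ ^ 2 + 2 * (h * (|C₃| * ‖x - y‖ ^ 2)) + h ^ 2 * (L * ‖x - y‖) ^ 2 := by
        gcongr
        exact hosl.trans h4
    _ = (1 + 2 * |C₃| * h + h * (h * L ^ 2)) * ‖x - y‖ ^ 2 := by ring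
    _ ≤ (2 * (|C₃| + 1) * h + 1) * ‖x - y‖ ^ 2 := by
        refine mul_le_mul_of_nonneg_right ?_ (sq_nonneg _)
        nlinarith
    _ ≤ _ := by gcongr

lemma norm_fderiv_comp_shift_le {E : Type*} [NormedAddCommGroup E] [InnerProductSpace ℝ E]
    {C₃ L h R M : ℝ} (hh : 0 ≤ h) (hhL : h * L ^ 2 ≤ 1) {β : E → E}
    (hosl : ∀ x y, ⟪β x - β y, x - y⟫ ≤ C₃ * ‖x - y‖ ^ 2)
    (hlip : ∀ x ∈ ball (0:E) (R + 1), ∀ y ∈ ball (0:E) (R + 1), ‖β x - β y‖ ≤ L * ‖x - y‖)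
    {w : E → ℝ} (hw : ContDiff ℝ 1 w) (hM : ∀ x, ‖fderiv ℝ w x‖ ≤ M)
    (hsupp : ∀ x, R < ‖x‖ → w (x + h • β x) = 0) (x : E) :
    ‖fderiv ℝ (fun y => w (y + h • β y)) x‖ ≤ M * Real.exp ((|C₃| + 1) * h) := by
  have hM0 : 0 ≤ M := (norm_nonneg _).trans (hM 0)
  by_cases hx : ‖x‖ ≤ R
  · have hball : ball (0:E) (R + 1) ∈ 𝓝 x :=
      isOpen_ball.mem_nhds (mem_ball_zero_iff.2 (by linarith))
    have hwL : ∀ y z, ‖w y - w z‖ ≤ M * ‖y - z‖ := fun y z =>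
      convex_univ.norm_image_sub_le_of_norm_fderiv_le (𝕜 := ℝ)
        (fun p _ => hw.differentiable one_ne_zero p) (fun p _ => hM p) (mem_univ z) (mem_univ y)
    have := norm_fderiv_le_of_lipschitzOn ℝ (f := fun y => w (y + h • β y))
      (C := ⟨M * Real.exp ((|C₃| + 1) * h), by positivity⟩) hball
      (LipschitzOnWith.of_dist_le_mul fun y hy z hz => ?_)
    · exact this
    · rw [dist_eq_norm, dist_eq_norm]
      refine (hwL _ _).trans ?_
      change _ ≤ M * Real.exp ((|C₃| + 1) * h) * ‖y - z‖
      rw [mul_assoc]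
      exact mul_le_mul_of_nonneg_left
        (norm_shift_sub_shift_le hh hhL (hosl y z) (hlip y hy z hz)) hM0
  · rw [fderiv_eq_zero_of_norm_gt hsupp (not_le.1 hx), norm_zero]
    positivity

/-- The transport functional of a weak null solution vanishes: test functions are moved backward
in time by an Euler scheme along smooth approximations of the field, the one-sided Lipschitz
condition keeping their gradients under control. -/
lemma IsWeakNullSolution.integral_transport_eq_zero {E : Type*} [NormedAddCommGroup E]
    [InnerProductSpace ℝ E] [FiniteDimensional ℝ E] {T : ℝ} {b : E → ℝ → E}
    {Δ : ℝ → (E → ℝ) → ℝ} (hΔ : IsWeakNullSolution T b Δ)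
    (hb : Continuous (fun q : E × ℝ => b q.1 q.2)) {C C₃ : ℝ} (hC : 0 ≤ C)
    (hgrowth : ∀ x, ∀ t ∈ Icc (0:ℝ) T, ‖b x t‖ ≤ C * (1 + ‖x‖))
    (hosl : ∀ x y, ∀ t ∈ Icc (0:ℝ) T, ⟪b x t - b y t, x - y⟫ ≤ C₃ * ‖x - y‖ ^ 2)
    {w : E → ℝ} (hw : ContDiff ℝ 1 w) {r : ℝ} (hr : ∀ x, r < ‖x‖ → w x = 0)
    {c : ℝ} (hc0 : 0 < c) (hcT : c < T) :
    ∫ s in (0:ℝ)..c, Δ s (fun x => fderiv ℝ w x (b x s)) = 0 := by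
  have hcs : HasCompactSupport w := HasCompactSupport.intro (isCompact_closedBall (0:E) r)
    fun x hx => hr x (by simpa using hx)
  obtain ⟨K, hK⟩ := hw.lipschitzWith_of_hasCompactSupport hcs one_ne_zero
  set κ : ℝ := |C₃| + 1 with hκ
  have hκ0 : 0 ≤ κ := by positivity
  set C' : ℝ := 4 * C with hC'
  have hC'0 : 0 ≤ C' := by positivity
  set ρ : ℝ → ℝ := fun t => (1 + max r 0) * Real.exp (2 * C' * (c - t)) with hρ
  set m : ℝ → ℝ := fun t => K * Real.exp (κ * (c - t)) with hm
  set R : ℝ := ρ 0 with hR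
  set M : ℝ := m 0 with hM
  have hR0 : 0 ≤ R := by positivity
  have hM0 : 0 ≤ M := by positivity
  have hρR : ∀ t, 0 ≤ t → ρ t ≤ R := fun t ht => by
    simp only [hR, hρ]
    gcongr
  have hmM : ∀ t, 0 ≤ t → m t ≤ M := fun t ht => by
    simp only [hM, hm]
    gcongr
  obtain ⟨g, hg, hg0, hgΔ⟩ := hΔ.bound R
  have hgi : ∀ {s t : ℝ}, 0 ≤ s → s ≤ t → t ≤ T → IntervalIntegrable g volume s t :=
    fun hs hst ht =>
      (intervalIntegrable_iff_integrableOn_Icc_of_le hst).2 (hg.mono_set (Icc_subset_Icc hs ht))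
  have key : ∀ ε > 0, |∫ s in (0:ℝ)..c, Δ s (fun x => fderiv ℝ w x (b x s))|
      ≤ M * (2 * ε + ε) * (∫ s in (0:ℝ)..c, g s) + ε * c := by
    intro ε hε
    obtain ⟨β, L, hL0, hβ⟩ := exists_smooth_oneSidedLipschitz_approx hb hC hgrowth hosl hR0 hε
    obtain ⟨δ, hδ, hδb⟩ := Metric.uniformContinuousOn_iff_le.1
      (((isCompact_closedBall (0:E) R).prod (isCompact_Icc (a := (0:ℝ)) (b := T))
        ).uniformContinuousOn_of_continuous hb.continuousOn) ε hε
    obtain ⟨N, hN0, hNδ, hNL, hNC, hNL2⟩ : ∃ N : ℕ, 0 < N ∧ c / N ≤ δ ∧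
        c / N * (L * (C * (1 + R))) ≤ ε ∧ c / N * C' ≤ 1 / 2 ∧ c / N * L ^ 2 ≤ 1 := by
      have hlim := tendsto_const_div_atTop_nhds_zero_nat c
      have hlim' : ∀ k : ℝ, Tendsto (fun n : ℕ => c / n * k) atTop (𝓝 0) := fun k => by
        simpa using hlim.mul_const k
      exact ((eventually_gt_atTop 0).and ((hlim.eventually_le_const hδ).and
        (((hlim' _).eventually_le_const hε).and (((hlim' _).eventually_le_const (by norm_num)).and
          ((hlim' _).eventually_le_const one_pos))))).exists
    set h : ℝ := c / N with hh
    have hN0' : (0:ℝ) < N := Nat.cast_pos.2 hN0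
    have hh0 : 0 < h := by positivity
    have hNh : N * h = c := by
      rw [hh]
      field_simp
    have main : ∀ k : ℕ, k ≤ N → ∀ v : E → ℝ, ContDiff ℝ 1 v →
        (∀ x, ρ (k * h) < 1 + ‖x‖ → v x = 0) → (∀ x, ‖fderiv ℝ v x‖ ≤ m (k * h)) →
        |∫ s in (0:ℝ)..k * h, Δ s (fun x => fderiv ℝ v x (b x s))|
          ≤ M * (2 * ε + ε) * (∫ s in (0:ℝ)..k * h, g s) + ε * (k * h) := by
      intro k
      induction k with
      | zero => intros; simp
      | succ k ih =>
        intro hk v hv hvρ hvm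
        set a : ℝ := k * h with ha
        set e : ℝ := (k + 1 : ℕ) * h with he
        have hae : e = a + h := by
          rw [he, ha]
          push_cast
          ring
        have ha0 : 0 ≤ a := by positivity
        have hec : e ≤ c := by
          rw [← hNh]
          exact mul_le_mul_of_nonneg_right (Nat.cast_le.2 hk) hh0.le
        have heT : e < T := hec.trans_lt hcT
        have haT : a ∈ Icc (0:ℝ) T := ⟨ha0, by linarith⟩
        obtain ⟨hβc, hβg, hβo, hβb, hβL⟩ := hβ a haT
        have hsuppρ : ∀ h', 0 ≤ h' → h' ≤ h → ∀ x, ρ a < 1 + ‖x‖ → v (x + h' • β a x) = 0 := by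
          intro h' h'0 h'h x hx
          refine hvρ _ ?_
          have h1 := one_add_norm_le_exp_mul_shift hC'0 h'0
            ((mul_le_mul_of_nonneg_right h'h hC'0).trans hNC) (hβg x)
          have h2 : Real.exp (2 * C' * h') ≤ Real.exp (2 * C' * h) := by gcongr
          have h3 : ρ a = Real.exp (2 * C' * h) * ρ e := by
            simp only [hρ]
            rw [mul_left_comm (Real.exp _) (1 + max r 0), ← Real.exp_add, hae]
            ring_nf
          have h4 : Real.exp (2 * C' * h) * ρ e
              < Real.exp (2 * C' * h) * (1 + ‖x + h' • β a x‖) := by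
            rw [← h3]
            refine hx.trans_le (h1.trans ?_)
            gcongr
          exact lt_of_mul_lt_mul_left h4 (Real.exp_nonneg _)
        have hsuppR : ∀ h', 0 ≤ h' → h' ≤ h → ∀ x, R < ‖x‖ → v (x + h' • β a x) = 0 :=
          fun h' h'0 h'h x hx => hsuppρ h' h'0 h'h x (by linarith [hρR a ha0])
        have heh : e - a = h := by linarith
        have hβL' : ∀ x, ‖x‖ ≤ R → ‖fderiv ℝ (β a) x‖ ≤ L := fun x hx =>
          norm_fderiv_le_of_lipschitzOn ℝ (C := ⟨L, hL0⟩)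
            (isOpen_ball.mem_nhds (mem_ball_zero_iff.2 (by linarith : ‖x‖ < R + 1)))
            (LipschitzOnWith.of_dist_le_mul fun y hy z hz => by
              rw [dist_eq_norm, dist_eq_norm]
              exact hβL y hy z hz)
        have hbβ : ∀ x, ‖x‖ ≤ R → ∀ s ∈ Icc a e, ‖b x s - β a x‖ ≤ 2 * ε := by
          intro x hx s hs
          have hsT : s ∈ Icc (0:ℝ) T := ⟨ha0.trans hs.1, hs.2.trans heT.le⟩
          have h1 := hδb (x, s) ⟨by simpa using hx, hsT⟩ (x, a) ⟨by simpa using hx, haT⟩ (by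
            rw [Prod.dist_eq, dist_self, Real.dist_eq, abs_of_nonneg (sub_nonneg.2 hs.1)]
            exact max_le hδ.le (by linarith [hs.2]))
          rw [dist_eq_norm] at h1
          have h2 := norm_sub_le_norm_sub_add_norm_sub (b x s) (b x a) (β a x)
          linarith [hβb x hx]
        have hDβ : ∀ x, ‖x‖ ≤ R → ∀ s ∈ Icc a e,
            (e - a) * ‖fderiv ℝ (β a) x (b x s)‖ ≤ ε := by
          intro x hx s hs
          have hsT : s ∈ Icc (0:ℝ) T := ⟨ha0.trans hs.1, hs.2.trans heT.le⟩
          rw [heh]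
          refine le_trans ?_ hNL
          gcongr
          refine (ContinuousLinearMap.le_opNorm _ _).trans ?_
          gcongr
          · exact hβL' x hx
          · exact (hgrowth x s hsT).trans (by gcongr)
        obtain ⟨h', h'0, h'h, hstep⟩ := hΔ.exists_euler_step hb ha0
          (by linarith : a < e) heT hβc hv (R := R) (M := M) (B := C' * (1 + R))
          (ε₁ := 2 * ε) (ε₂ := ε)
          (fun h' h'0 h'h => hsuppR h' h'0 (h'h.trans_eq heh))
          (fun x => (hvm x).trans (hmM e (by linarith))) (by positivity) (by positivity) hε.le
          (fun x hx => (hβg x).trans (by gcongr))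
          hbβ hDβ hg hgΔ (mul_pos hε hh0)
        rw [heh] at h'h
        have hih := ih (Nat.le_of_succ_le hk) (fun y => v (y + h' • β a y))
          (hv.comp (contDiff_id.add (contDiff_const.smul hβc)))
          (fun x hx => hsuppρ h' h'0 h'h x hx) fun x => ?_
        · have hsum := intervalIntegral.integral_add_adjacent_intervals
            (hgi le_rfl ha0 haT.2) (hgi ha0 (by linarith : a ≤ e) heT.le)
          rw [← hsum, hae]
          rw [hae] at hstep
          have habs := abs_sub_abs_le_abs_sub
            (∫ s in (0:ℝ)..a + h, Δ s fun x => fderiv ℝ v x (b x s))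
            (∫ s in (0:ℝ)..a, Δ s fun x => fderiv ℝ (fun y => v (y + h' • β a y)) x (b x s))
          linarith
        · refine (norm_fderiv_comp_shift_le h'0
            ((mul_le_mul_of_nonneg_right h'h (sq_nonneg L)).trans hNL2) hβo hβL hv hvm
            (hsuppR h' h'0 h'h) x).trans ?_
          calc m e * Real.exp ((|C₃| + 1) * h') ≤ m e * Real.exp (κ * h) := by gcongr
            _ = m a := by
              simp only [hm]
              rw [mul_assoc, ← Real.exp_add, hae]
              ring_nf
    have := main N le_rfl w hw (fun x hx => hr x ?_) fun x => ?_
    · rwa [hNh] at this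
    · simp only [hNh, hρ, sub_self, mul_zero, Real.exp_zero, mul_one] at hx
      linarith [le_max_left r 0]
    · simpa [hNh, hm] using norm_fderiv_le_of_lipschitz ℝ hK
  have hlim : Tendsto (fun ε : ℝ => M * (2 * ε + ε) * (∫ s in (0:ℝ)..c, g s) + ε * c)
      (𝓝[>] 0) (𝓝 0) := by
    have : Continuous fun ε : ℝ => M * (2 * ε + ε) * (∫ s in (0:ℝ)..c, g s) + ε * c := by fun_prop
    simpa using (this.tendsto 0).mono_left nhdsWithin_le_nhds
  exact abs_nonpos_iff.1 (ge_of_tendsto hlim (by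
    filter_upwards [self_mem_nhdsWithin] with ε hε using key ε hε))

/-- **Example (one-sided Lipschitz drift).** If `b ∈ C(ℝ^d × ℝ, ℝ^d)` satisfies
`|b(x,t)| ≤ C₁ + C₂|x|` and `⟨b(x+ξ,t) - b(x,t), ξ⟩ ≤ C₃|ξ|²` on `ℝ^d × [0,T]`,
then the Cauchy problem `∂_t μ + div(b μ) = 0`, `μ|_{t=0} = ν` has at most one
solution in the class of all locally bounded measures given by families of
locally bounded measures `(μ_t)_{t∈[0,T]}`. -/
theorem uniqueness_one_sided_lipschitz
    {d : ℕ} (T : ℝ) (hT : 0 < T)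
    (b : EuclideanSpace ℝ (Fin d) → ℝ → EuclideanSpace ℝ (Fin d))
    (hb : Continuous (fun q : EuclideanSpace ℝ (Fin d) × ℝ => b q.1 q.2))
    (C₁ C₂ C₃ : ℝ)
    (hgrowth : ∀ x : EuclideanSpace ℝ (Fin d), ∀ t ∈ Icc (0:ℝ) T,
      ‖b x t‖ ≤ C₁ + C₂ * ‖x‖)
    (hosl : ∀ x : EuclideanSpace ℝ (Fin d), ∀ t ∈ Icc (0:ℝ) T,
      ∀ ξ : EuclideanSpace ℝ (Fin d), ⟪b (x + ξ) t - b x t, ξ⟫ ≤ C₃ * ‖ξ‖ ^ 2)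
    (νp νn : Measure (EuclideanSpace ℝ (Fin d)))
    (hν : ∀ K : Set (EuclideanSpace ℝ (Fin d)), IsCompact K → νp K < ⊤ ∧ νn K < ⊤)
    (p₁ n₁ p₂ n₂ : ℝ → Measure (EuclideanSpace ℝ (Fin d)))
    (hfam₁ : IsLocFamily T p₁ n₁) (hfam₂ : IsLocFamily T p₂ n₂)
    (hsol₁ : IsSolution T b νp νn p₁ n₁) (hsol₂ : IsSolution T b νp νn p₂ n₂) :
    ∀ᵐ t ∂(volume.restrict (Icc (0:ℝ) T)), p₁ t + n₂ t = p₂ t + n₁ t := by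
  have hΔ := isWeakNullSolution_sint_sub hb hfam₁ hfam₂ hsol₁ hsol₂
  have hgrowth' : ∀ x, ∀ t ∈ Icc (0:ℝ) T, ‖b x t‖ ≤ (|C₁| + |C₂|) * (1 + ‖x‖) := by
    intro x t ht
    refine (hgrowth x t ht).trans ?_
    nlinarith [le_abs_self C₁, abs_nonneg C₂, norm_nonneg x,
      mul_le_mul_of_nonneg_right (le_abs_self C₂) (norm_nonneg x),
      mul_nonneg (abs_nonneg C₁) (norm_nonneg x)]
  have hosl' : ∀ x y, ∀ t ∈ Icc (0:ℝ) T, ⟪b x t - b y t, x - y⟫ ≤ C₃ * ‖x - y‖ ^ 2 :=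
    fun x y t ht => by simpa using hosl y t ht (x - y)
  obtain ⟨W, hWc, hW, hsep⟩ :=
    exists_countable_separating_contDiff (EuclideanSpace ℝ (Fin d))
  have hae : ∀ᵐ t ∂(volume.restrict (Icc (0:ℝ) T)), ∀ w ∈ W,
      sint p₁ n₁ t w - sint p₂ n₂ t w = 0 := by
    refine (ae_ball_iff hWc).2 fun w hw => ?_
    obtain ⟨hwc, R, hwR⟩ := hW w hw
    have hends : ∀ᵐ t ∂(volume.restrict (Icc (0:ℝ) T)), t ≠ 0 ∧ t ≠ T :=
      ae_restrict_of_ae ((Measure.ae_ne volume 0).and (Measure.ae_ne volume T))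
    filter_upwards [hΔ.weak (fun q => w q.1) R (hwc.comp contDiff_fst) fun x _ hx => hwR x hx,
      ae_restrict_mem measurableSet_Icc, hends] with t ht htT hne
    refine ht.trans ?_
    simp only [fderiv_comp_fst_apply hwc]
    exact hΔ.integral_transport_eq_zero hb (by positivity) hgrowth' hosl' hwc hwR
      (lt_of_le_of_ne htT.1 hne.1.symm) (lt_of_le_of_ne htT.2 hne.2)
  filter_upwards [hae, ae_restrict_mem measurableSet_Icc] with t ht htT
  exact hsep (p₁ t) (n₁ t) (p₂ t) (n₂ t) (fun K hK => (hfam₁.1 t htT K hK).1)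
    (fun K hK => (hfam₁.1 t htT K hK).2) (fun K hK => (hfam₂.1 t htT K hK).1)
    (fun K hK => (hfam₂.1 t htT K hK).2) fun w hw => sub_eq_zero.1 (ht w hw)
end
end
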